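/- There exists a constant c > 0, depending only on n, D, and L, such that the following holds. Let (M,d) be a closed, connected metric manifold of dimension n ≥ 1 that is D-doubling and L-linearly locally contractible. If S ⊆ M is a closed set, x, y ∈ M ∖ S lie in different connected components of M ∖ S, and d(s,x) ≥ r and d(s,y) ≥ r for all s ∈ S (for some r > 0), then H_{n−1}(S) ≥ c · r^{n−1}. -/

import Mathlib

open Metric MeasureTheory

/-- `M` is a topological `n`-manifold: every point has an open neighborhood
homeomorphic to an open subset of `ℝⁿ`. -/
def IsTopManifold (n : ℕ) (M : Type*) [TopologicalSpace M] : Prop :=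
  ∀ x : M, ∃ (U : Set M) (V : Set (EuclideanSpace ℝ (Fin n))),
    IsOpen U ∧ x ∈ U ∧ IsOpen V ∧ Nonempty (U ≃ₜ V)

/-- `M` is `D`-doubling: every open ball `B(z,r)` contains at most `D` points that are
pairwise at distance `≥ r/2` from each other. -/
def IsDoubling (D : ℕ) (M : Type*) [MetricSpace M] : Prop :=
  ∀ (z : M) (r : ℝ) (s : Finset M), (↑s ⊆ ball z r) →
    (∀ a ∈ s, ∀ b ∈ s, a ≠ b → r / 2 ≤ dist a b) → s.card ≤ D

/-- `M` is `L`-linearly locally contractible: every ball `B(z,r)` with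
`0 < r ≤ diam M / L` can be contracted to a point inside `B(z,Lr)`. -/
def IsLLC (L : ℝ) (M : Type*) [MetricSpace M] : Prop :=
  ∀ (z : M) (r : ℝ), 0 < r → r ≤ diam (Set.univ : Set M) / L →
    ∃ h : ℝ → M → M,
      ContinuousOn (fun p : ℝ × M => h p.1 p.2) (Set.Icc 0 1 ×ˢ ball z r) ∧
      (∀ x ∈ ball z r, h 0 x = x) ∧
      (∃ c : M, ∀ x ∈ ball z r, h 1 x = c) ∧
      (∀ t ∈ Set.Icc (0:ℝ) 1, ∀ x ∈ ball z r, h t x ∈ ball z (L * r))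


/-! ### Finite simplices over `ZMod 2` -/

namespace SmallSimplices

open Finset

section Chains

open scoped Classical

variable {X Y Z : Type*}

/-- Chains of unordered simplices (the empty simplex included), modulo two. -/
abbrev Chain (X : Type*) := Finset X →₀ ZMod 2

/-- Cochains on unordered simplices, modulo two. -/
abbrev Coch (X : Type*) := Finset X → ZMod 2

noncomputable def simplex (s : Finset X) : Chain X := Finsupp.single s 1

noncomputable def bd : Chain X →ₗ[ZMod 2] Chain X :=
  Finsupp.linearCombination (ZMod 2) fun s => ∑ v ∈ s, simplex (s.erase v)

noncomputable def cone (v : X) : Chain X →ₗ[ZMod 2] Chain X :=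
  Finsupp.linearCombination (ZMod 2) fun s => if v ∈ s then 0 else simplex (insert v s)

noncomputable def push (f : X → Y) : Chain X →ₗ[ZMod 2] Chain Y :=
  Finsupp.linearCombination (ZMod 2) fun s => if Set.InjOn f s then simplex (s.image f) else 0

noncomputable def ev (a : Coch X) : Chain X →ₗ[ZMod 2] ZMod 2 :=
  Finsupp.linearCombination (ZMod 2) a

/-- The coboundary of a cochain. -/
noncomputable def cob (a : Coch X) : Coch X := fun s => ∑ v ∈ s, a (s.erase v)

/-- The pullback of a cochain by a map; it vanishes on collapsed simplices. -/
noncomputable def pull (f : X → Y) (a : Coch Y) : Coch X :=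
  fun s => if Set.InjOn f s then a (s.image f) else 0

@[simp] lemma bd_simplex (s : Finset X) : bd (simplex s) = ∑ v ∈ s, simplex (s.erase v) := by
  simp [bd, simplex]

@[simp] lemma cone_simplex (v : X) (s : Finset X) :
    cone v (simplex s) = if v ∈ s then 0 else simplex (insert v s) := by
  simp [cone, simplex]

@[simp] lemma push_simplex (f : X → Y) (s : Finset X) :
    push f (simplex s) = if Set.InjOn f s then simplex (s.image f) else 0 := by
  simp [push, simplex]

@[simp] lemma ev_simplex (a : Coch X) (s : Finset X) : ev a (simplex s) = a s := by
  simp [ev, simplex]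

lemma cob_eq_ev (a : Coch X) (s : Finset X) : cob a s = ev a (bd (simplex s)) := by
  simp [cob]

lemma pull_eq_ev (f : X → Y) (a : Coch Y) (s : Finset X) :
    pull f a s = ev a (push f (simplex s)) := by
  simp only [pull, push_simplex]
  split_ifs <;> simp

lemma chain_hom_ext {V : Type*} [AddCommGroup V] [Module (ZMod 2) V]
    {F G : Chain X →ₗ[ZMod 2] V} (h : ∀ s, F (simplex s) = G (simplex s)) : F = G := by
  ext s
  simpa [simplex] using h s

lemma ev_cob (a : Coch X) (c : Chain X) : ev (cob a) c = ev a (bd c) := by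
  have : ev (cob a) = (ev a).comp bd := chain_hom_ext fun s => by
    simpa using cob_eq_ev a s
  rw [this]; rfl

lemma bd_bd (c : Chain X) : bd (bd c) = 0 := by
  suffices h : (bd.comp bd : Chain X →ₗ[ZMod 2] Chain X) = 0 from LinearMap.congr_fun h c
  refine chain_hom_ext fun s => ?_
  simp only [LinearMap.comp_apply, bd_simplex, map_sum, LinearMap.zero_apply]
  rw [Finset.sum_sigma']
  refine Finset.sum_involution (fun x _ => ⟨x.2, x.1⟩) ?_ ?_ ?_ ?_
  · rintro ⟨v, w⟩ h
    simp only [Finset.erase_right_comm (a := w) (b := v)]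
    exact ZModModule.add_self _
  · rintro ⟨v, w⟩ h _ he
    simp at h he
    exact h.2.1 he.1
  · rintro ⟨v, w⟩ h
    simp at h ⊢
    exact ⟨h.2.2, fun e => h.2.1 e.symm, h.1⟩
  · rintro ⟨v, w⟩ h; rfl

lemma cob_cob (a : Coch X) : cob (cob a) = 0 := by
  funext s
  rw [cob_eq_ev, ev_cob, bd_bd]; simp

lemma cob_add (a b : Coch X) : cob (a + b) = cob a + cob b := by
  funext s; simp [cob, Finset.sum_add_distrib]

lemma bd_cone (v : X) (c : Chain X) : bd (cone v c) = c + cone v (bd c) := by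
  suffices h : (bd.comp (cone v) : Chain X →ₗ[ZMod 2] Chain X)
      = LinearMap.id + (cone v).comp bd from LinearMap.congr_fun h c
  refine chain_hom_ext fun s => ?_
  simp only [LinearMap.comp_apply, cone_simplex, LinearMap.add_apply, LinearMap.id_apply,
    bd_simplex, map_sum]
  by_cases hv : v ∈ s
  · rw [if_pos hv, map_zero, Finset.sum_eq_single_of_mem v hv]
    · simp [Finset.insert_erase hv, ZModModule.add_self]
    · intro w hw hne
      rw [if_pos]; simp [hv, hne.symm]
  · rw [if_neg hv, bd_simplex, Finset.sum_insert hv, Finset.erase_insert hv]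
    congr 1
    refine Finset.sum_congr rfl fun w hw => ?_
    have hne : w ≠ v := fun e => hv (e ▸ hw)
    rw [if_neg (by simp [hv]), Finset.erase_insert_of_ne hne.symm]

lemma bd_push (f : X → Y) (c : Chain X) : bd (push f c) = push f (bd c) := by
  suffices h : (bd.comp (push f) : Chain X →ₗ[ZMod 2] Chain Y) = (push f).comp bd from
    LinearMap.congr_fun h c
  refine chain_hom_ext fun s => ?_
  simp only [LinearMap.comp_apply, push_simplex, bd_simplex, map_sum]
  by_cases hf : Set.InjOn f s
  · rw [if_pos hf, bd_simplex, Finset.sum_image hf]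
    refine Finset.sum_congr rfl fun w hw => ?_
    rw [if_pos (hf.mono (by simp))]
    congr 1
    ext y
    simp only [Finset.mem_erase, Finset.mem_image]
    constructor
    · rintro ⟨h, x, hx, rfl⟩
      exact ⟨x, ⟨fun e => h (by rw [e]), hx⟩, rfl⟩
    · rintro ⟨x, ⟨h, hx⟩, rfl⟩
      exact ⟨fun e => h (hf hx hw e), x, hx, rfl⟩
  · rw [if_neg hf, map_zero]
    simp only [Set.InjOn, not_forall] at hf
    obtain ⟨v, hv, w, hw, hfe, hne⟩ := hf
    change v ≠ w at hne
    rw [Finset.mem_coe] at hv hw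
    have key : ∀ v w, v ∈ s → w ∈ s → f v = f w → v ≠ w → Set.InjOn f (s.erase v : Finset X) →
        Set.InjOn f (s.erase w : Finset X) ∧ (s.erase v).image f = (s.erase w).image f := by
      intro v w hv hw hfe hne hi
      have hi' : ∀ a ∈ s, ∀ b ∈ s, a ≠ v → b ≠ v → f a = f b → a = b :=
        fun a ha b hb hav hbv e => hi (by simp [ha, hav]) (by simp [hb, hbv]) e
      constructor
      · intro a ha b hb e
        simp only [Finset.coe_erase, Set.mem_sdiff, Finset.mem_coe, Set.mem_singleton_iff] at ha hb
        by_cases hav : a = v <;> by_cases hbv : b = v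
        · rw [hav, hbv]
        · exact absurd (hi' b hb.1 w hw hbv hne.symm (by rw [← e, hav, hfe])) hb.2
        · exact absurd (hi' a ha.1 w hw hav hne.symm (by rw [e, hbv, hfe])) ha.2
        · exact hi' a ha.1 b hb.1 hav hbv e
      · ext y
        simp only [Finset.mem_image, Finset.mem_erase]
        constructor
        · rintro ⟨x, ⟨hxv, hx⟩, rfl⟩
          by_cases hxw : x = w
          · exact ⟨v, ⟨hne, hv⟩, by rw [hfe, hxw]⟩
          · exact ⟨x, ⟨hxw, hx⟩, rfl⟩
        · rintro ⟨x, ⟨hxw, hx⟩, rfl⟩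
          by_cases hxv : x = v
          · exact ⟨w, ⟨hne.symm, hw⟩, by rw [← hfe, hxv]⟩
          · exact ⟨x, ⟨hxv, hx⟩, rfl⟩
    rw [← Finset.add_sum_erase _ _ hv, ← Finset.add_sum_erase _ _
      (show w ∈ s.erase v by simp [hw, hne.symm]), Finset.sum_eq_zero, add_zero]
    · by_cases h : Set.InjOn f (s.erase v : Finset X)
      · obtain ⟨h1, h2⟩ := key v w hv hw hfe hne h
        rw [if_pos h, if_pos h1, h2, ZModModule.add_self]
      · rw [if_neg h, if_neg, add_zero]
        intro h1
        exact h (key w v hw hv hfe.symm hne.symm h1).1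
    · intro u hu
      simp only [Finset.mem_erase] at hu
      rw [if_neg]
      intro h
      exact hne (h (by simp [hv, hu.2.1.symm]) (by simp [hw, hu.1.symm]) hfe)

lemma cob_pull (f : X → Y) (a : Coch Y) : cob (pull f a) = pull f (cob a) := by
  funext s
  have h : ev (pull f a) = (ev a).comp (push f) := chain_hom_ext fun s => by
    simpa using pull_eq_ev f a s
  rw [cob_eq_ev, pull_eq_ev, ev_cob, h, LinearMap.comp_apply, bd_push]

lemma pull_add (f : X → Y) (a b : Coch Y) : pull f (a + b) = pull f a + pull f b := by
  funext s; simp only [pull, Pi.add_apply]; split_ifs <;> simp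

/-- Chains built from simplices in a given family. -/
abbrev chainsIn (A : Set (Finset X)) : Submodule (ZMod 2) (Chain X) :=
  Finsupp.supported (ZMod 2) (ZMod 2) A

lemma simplex_mem {A : Set (Finset X)} {s : Finset X} (h : s ∈ A) : simplex s ∈ chainsIn A :=
  Finsupp.single_mem_supported _ _ h

lemma map_mem_of_chainsIn {V : Type*} [AddCommGroup V] [Module (ZMod 2) V]
    {F : Chain X →ₗ[ZMod 2] V} {A : Set (Finset X)} {P : Submodule (ZMod 2) V}
    (h : ∀ s ∈ A, F (simplex s) ∈ P) {c : Chain X} (hc : c ∈ chainsIn A) : F c ∈ P := by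
  have : chainsIn A ≤ P.comap F := by
    rw [chainsIn, Finsupp.supported_eq_span_single, Submodule.span_le]
    rintro _ ⟨s, hs, rfl⟩
    exact h s hs
  exact this hc

lemma ev_eq_zero {a : Coch X} {A : Set (Finset X)} (h : ∀ s ∈ A, a s = 0) {c : Chain X}
    (hc : c ∈ chainsIn A) : ev a c = 0 := by
  rw [ev, Finsupp.linearCombination_apply]
  exact Finset.sum_eq_zero fun s hs => by simp [h s (hc hs)]

lemma chainsIn_mono {A B : Set (Finset X)} (h : A ⊆ B) : chainsIn A ≤ chainsIn B :=
  Finsupp.supported_mono h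

/-- Recursive construction of chain maps and chain homotopies carried by a family `A`. -/
lemma exists_carried (φ : Finset X → Chain Y)
    (hφ : ∀ s, bd (φ s) = ∑ v ∈ s, φ (s.erase v))
    (A : Finset X → Set (Chain Y)) (𝒦 : Set (Finset X))
    (h𝒦 : ∀ s ∈ 𝒦, ∀ v ∈ s, s.erase v ∈ 𝒦) (t₀ : Chain Y) (ht₀ : t₀ ∈ A ∅)
    (hφ₀ : bd t₀ = φ ∅)
    (hA : ∀ s ∈ 𝒦, s.Nonempty → ∀ t : Finset X → Chain Y,
      (∀ v ∈ s, t (s.erase v) ∈ A (s.erase v)) →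
      bd (φ s + ∑ v ∈ s, t (s.erase v)) = 0 →
      ∃ w ∈ A s, bd w = φ s + ∑ v ∈ s, t (s.erase v)) :
    ∃ t : Finset X → Chain Y, t ∅ = t₀ ∧
      ∀ s ∈ 𝒦, t s ∈ A s ∧ bd (t s) = φ s + ∑ v ∈ s, t (s.erase v) := by
  let P (s : Finset X) (c w : Chain Y) : Prop := w ∈ A s ∧ bd w = φ s + c
  let step (s : Finset X) (c : Chain Y) : Chain Y :=
    if s = ∅ then t₀ else if h : ∃ w, P s c w then h.choose else 0
  let F : (s : Finset X) → (∀ u, u ⊂ s → Chain Y) → Chain Y := fun s ih =>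
    step s (∑ v : {v // v ∈ s}, ih (s.erase v) (Finset.erase_ssubset v.2))
  let t : Finset X → Chain Y := Finset.isWellFounded_ssubset.wf.fix F
  have ht : ∀ s, t s = step s (∑ v ∈ s, t (s.erase v)) := by
    intro s
    change Finset.isWellFounded_ssubset.wf.fix F s = _
    rw [WellFounded.fix_eq]
    change step s _ = _
    congr 1
    rw [← Finset.sum_coe_sort s]
  have ht0 : t ∅ = t₀ := by rw [ht]; simp [step]
  refine ⟨t, ht0, ?_⟩
  intro s
  induction s using Finset.strongInduction with
  | H s ih =>
    intro hs
    rcases s.eq_empty_or_nonempty with rfl | hne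
    · rw [ht0]; exact ⟨ht₀, by simp [hφ₀]⟩
    have ih' : ∀ v ∈ s, t (s.erase v) ∈ A (s.erase v) ∧
        bd (t (s.erase v)) = φ (s.erase v) + ∑ w ∈ s.erase v, t ((s.erase v).erase w) :=
      fun v hv => ih _ (Finset.erase_ssubset hv) (h𝒦 s hs v hv)
    have hcyc : bd (φ s + ∑ v ∈ s, t (s.erase v)) = 0 := by
      let τ : Chain X →ₗ[ZMod 2] Chain Y := Finsupp.linearCombination (ZMod 2) t
      have hτ : ∀ s, τ (simplex s) = t s := fun s => by simp [τ, simplex]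
      have hz : ∑ v ∈ s, ∑ w ∈ s.erase v, t ((s.erase v).erase w) = 0 := by
        have := congrArg τ (bd_bd (simplex s))
        simpa [hτ, map_sum] using this
      rw [map_add, hφ, map_sum, Finset.sum_congr rfl fun v hv => (ih' v hv).2,
        Finset.sum_add_distrib, hz, add_zero, ZModModule.add_self]
    obtain ⟨w, hw⟩ := hA s hs hne t (fun v hv => (ih' v hv).1) hcyc
    have hex : ∃ w, P s (∑ v ∈ s, t (s.erase v)) w := ⟨w, hw⟩
    have : t s = hex.choose := by
      rw [ht]; simp only [step]; rw [if_neg hne.ne_empty, dif_pos hex]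
    rw [this]
    exact hex.choose_spec

/-- The chain homotopy between two maps, carried by the simplices with vertices in the two
images. -/
lemma exists_chain_homotopy (f g : X → Y) : ∃ T : Chain X →ₗ[ZMod 2] Chain Y,
    (∀ c, bd (T c) + T (bd c) = push f c + push g c) ∧
    ∀ s : Finset X, T (simplex s) ∈
      chainsIn {t | (t : Set Y) ⊆ f '' s ∪ g '' s ∧ t.card = s.card + 1} := by
  let φ : Finset X → Chain Y := fun s => push f (simplex s) + push g (simplex s)
  have hpush : ∀ (h : X → Y) (s : Finset X), h '' (s : Set X) ⊆ f '' s ∪ g '' s →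
      push h (simplex s) ∈ chainsIn {t | (t : Set Y) ⊆ f '' s ∪ g '' s ∧ t.card = s.card} := by
    intro h s hs
    rw [push_simplex]
    split_ifs with hi
    · refine simplex_mem ⟨by simpa using hs, Finset.card_image_of_injOn hi⟩
    · exact zero_mem _
  obtain ⟨t, ht0, ht⟩ := exists_carried φ
    (by
      intro s
      simp only [φ, map_add, bd_push, bd_simplex, map_sum, Finset.sum_add_distrib])
    (fun s => {c | c ∈ chainsIn {t | (t : Set Y) ⊆ f '' s ∪ g '' s ∧ t.card = s.card + 1}})
    Set.univ (fun _ _ _ _ => trivial) 0 (Submodule.zero_mem (chainsIn _))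
    (by simp [φ, ZModModule.add_self])
    (by
      intro s _ hne t ht hz
      obtain ⟨x, hx⟩ := hne
      refine ⟨cone (f x) (φ s + ∑ v ∈ s, t (s.erase v)), ?_, ?_⟩
      · have hmem : φ s + ∑ v ∈ s, t (s.erase v) ∈
            chainsIn {t | (t : Set Y) ⊆ f '' s ∪ g '' s ∧ t.card = s.card} := by
          refine add_mem (add_mem (hpush f s Set.subset_union_left)
            (hpush g s Set.subset_union_right)) (sum_mem fun v hv => ?_)
          refine chainsIn_mono ?_ (ht v hv)
          rintro u ⟨hu, hc⟩
          refine ⟨hu.trans ?_, ?_⟩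
          · exact Set.union_subset_union (Set.image_mono (by simp)) (Set.image_mono (by simp))
          · rw [hc, Finset.card_erase_add_one hv]
        refine map_mem_of_chainsIn (F := cone (f x)) (P := chainsIn _) ?_ hmem
        rintro u ⟨hu, hc⟩
        rw [cone_simplex]
        split_ifs with h
        · exact zero_mem _
        · refine simplex_mem ⟨?_, by rw [Finset.card_insert_of_notMem h, hc]⟩
          rw [Finset.coe_insert]
          exact Set.insert_subset (Or.inl ⟨x, hx, rfl⟩) hu
      · rw [bd_cone, hz, map_zero, add_zero])
  let T : Chain X →ₗ[ZMod 2] Chain Y := Finsupp.linearCombination (ZMod 2) t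
  have hT : ∀ s, T (simplex s) = t s := fun s => by simp [T, simplex]
  refine ⟨T, fun c => ?_, fun s => by rw [hT]; exact (ht s trivial).1⟩
  have : bd.comp T + T.comp bd = push f + push g := chain_hom_ext fun s => by
    simp only [LinearMap.add_apply, LinearMap.comp_apply, hT, (ht s trivial).2, bd_simplex,
      map_sum, φ]
    rw [add_assoc, ZModModule.add_self, add_zero]
  exact LinearMap.congr_fun this c

lemma exists_homotopy (f g : X → Y) : ∃ T : Coch Y → Coch X,
    (∀ a, pull f a + pull g a = cob (T a) + T (cob a)) ∧
    ∀ a s, T a s ≠ 0 → ∃ t : Finset Y, (t : Set Y) ⊆ f '' s ∪ g '' s ∧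
      t.card = s.card + 1 ∧ a t ≠ 0 := by
  obtain ⟨T, hT, hTs⟩ := exists_chain_homotopy f g
  refine ⟨fun a s => ev a (T (simplex s)), fun a => ?_, fun a s h => ?_⟩
  · funext s
    have h : ev (fun s => ev a (T (simplex s))) = (ev a).comp T := chain_hom_ext fun s => by simp
    simp only [Pi.add_apply, pull_eq_ev, cob_eq_ev, ev_cob, h, LinearMap.comp_apply, ← map_add,
      ← hT]
    rw [add_comm]
  · by_contra! hc
    exact h (ev_eq_zero (fun t ht => hc t ht.1 ht.2) (hTs s))

/-! Elementary facts on pullbacks and coboundaries that do not mention decidability. -/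

lemma pull_ne_zero {f : X → Y} {a : Coch Y} {s : Finset X} (h : pull f a s ≠ 0) :
    ∃ t : Finset Y, (t : Set Y) = f '' s ∧ t.card = s.card ∧ a t ≠ 0 := by
  unfold pull at h
  split_ifs at h with hi
  · exact ⟨_, by simp, Finset.card_image_of_injOn hi, h⟩
  · exact absurd rfl h

lemma pull_eq_of_eqOn {f g : X → Y} {s : Finset X} (a : Coch Y) (h : Set.EqOn f g s) :
    pull f a s = pull g a s := by
  unfold pull
  simp only [h.injOn_iff, Finset.image_congr h]

lemma pull_id (a : Coch X) : pull id a = a := by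
  funext s; simp [pull, Set.injOn_id]

lemma pull_comp (f : X → Y) (g : Y → Z) (a : Coch Z) : pull f (pull g a) = pull (g ∘ f) a := by
  funext s
  unfold pull
  by_cases h : Set.InjOn f s
  · rw [if_pos h, Finset.image_image]
    congr 1
    simp only [Finset.coe_image, eq_iff_iff]
    exact ⟨fun h2 => h2.comp h (Set.mapsTo_image _ _), fun h2 => h2.image_of_comp⟩
  · rw [if_neg h, if_neg]
    exact fun h2 => h (Set.InjOn.of_comp h2)

lemma cob_ne_zero {a : Coch X} {s : Finset X} (h : cob a s ≠ 0) :
    ∃ v ∈ s, ∃ t ⊆ s, t.card + 1 = s.card ∧ (s : Set X) = insert v (t : Set X) ∧ a t ≠ 0 := by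
  obtain ⟨v, hv, h'⟩ := Finset.exists_ne_zero_of_sum_ne_zero h
  refine ⟨v, hv, s.erase v, Finset.erase_subset _ _, Finset.card_erase_add_one hv, ?_, h'⟩
  rw [← Finset.coe_insert, Finset.insert_erase hv]

lemma cob_congr {a b : Coch X} {s : Finset X} (h : ∀ t ⊆ s, t.card + 1 = s.card → a t = b t) :
    cob a s = cob b s :=
  Finset.sum_congr rfl fun _ hv => h _ (Finset.erase_subset _ _) (Finset.card_erase_add_one hv)

end Chains

end SmallSimplices

/-! ### Germs of cochains along small simplices -/

namespace SmallSimplices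

open Filter Topology

section Germs

open scoped Classical

variable {X Y Z : Type*} [MetricSpace X] [MetricSpace Y] [MetricSpace Z]

/-- All mutual distances of points of `s` are less than `ε`. -/
def Sm (ε : ℝ) (s : Finset X) : Prop := ∀ p ∈ s, ∀ q ∈ s, dist p q < ε

lemma Sm.mono {ε δ : ℝ} (h : ε ≤ δ) {s : Finset X} (hs : Sm ε s) : Sm δ s :=
  fun p hp q hq => (hs p hp q hq).trans_le h

lemma Sm.subset {ε : ℝ} {s t : Finset X} (h : t ⊆ s) (hs : Sm ε s) : Sm ε t :=
  fun p hp q hq => hs p (h hp) q (h hq)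

/-- The filter of arbitrarily small finite sets. -/
def smalls (X : Type*) [MetricSpace X] : Filter (Finset X) := ⨅ ε : {ε : ℝ // 0 < ε}, 𝓟 {s | Sm ε.1 s}

lemma eventually_smalls {P : Finset X → Prop} :
    (∀ᶠ s in smalls X, P s) ↔ ∃ ε > 0, ∀ s, Sm ε s → P s := by
  have hb : (smalls X).HasBasis (fun _ : {ε : ℝ // 0 < ε} => True) (fun ε => {s | Sm ε.1 s}) := by
    have : Nonempty {ε : ℝ // 0 < ε} := ⟨⟨1, one_pos⟩⟩
    refine hasBasis_iInf_principal ?_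
    intro a b
    refine ⟨⟨min a.1 b.1, lt_min a.2 b.2⟩, ?_, ?_⟩
    · exact fun s hs => Sm.mono (min_le_left _ _) hs
    · exact fun s hs => Sm.mono (min_le_right _ _) hs
  rw [hb.eventually_iff]
  simp

lemma eventually_sm {ε : ℝ} (h : 0 < ε) : ∀ᶠ s in smalls X, Sm ε s :=
  eventually_smalls.2 ⟨ε, h, fun _ hs => hs⟩

lemma eventually_subset {P : Finset X → Prop} (h : ∀ᶠ s in smalls X, P s) :
    ∀ᶠ s in smalls X, ∀ t ⊆ s, P t := by
  rw [eventually_smalls] at *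
  obtain ⟨ε, hε, h⟩ := h
  exact ⟨ε, hε, fun s hs t ht => h t (hs.subset ht)⟩

/-- Locally zero cochains. -/
def LZ (a : Coch X) : Prop := ∀ᶠ s in smalls X, a s = 0

lemma LZ.add {a b : Coch X} (ha : LZ a) (hb : LZ b) : LZ (a + b) := by
  filter_upwards [ha, hb] with s h1 h2
  simp [h1, h2]

lemma LZ.cob {a : Coch X} (ha : LZ a) : LZ (cob a) := by
  filter_upwards [eventually_subset ha] with s hs
  exact Finset.sum_eq_zero fun v _ => hs _ (Finset.erase_subset _ _)

lemma LZ.zero : LZ (0 : Coch X) := Eventually.of_forall fun _ => rfl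

lemma LZ.congr {a b : Coch X} (h : LZ a) (hab : LZ (a + b)) : LZ b := by
  filter_upwards [h, hab] with s h1 h2
  simpa [h1] using h2

/-- `a` is, on small simplices, a cochain on simplices with `k` vertices with compact support
in `W`. -/
def IsCochain (k : ℕ) (W : Set X) (a : Coch X) : Prop :=
  ∃ K, IsCompact K ∧ K ⊆ W ∧
    ∀ᶠ s in smalls X, a s ≠ 0 → s.Nonempty ∧ s.card = k ∧ (s : Set X) ⊆ K

lemma IsCochain.mono {k : ℕ} {U W : Set X} (h : U ⊆ W) {a : Coch X} (ha : IsCochain k U a) :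
    IsCochain k W a := by
  obtain ⟨K, h1, h2, h3⟩ := ha
  exact ⟨K, h1, h2.trans h, h3⟩

lemma IsCochain.of_imp {k : ℕ} {W : Set X} {a b : Coch X} (ha : IsCochain k W a)
    (h : ∀ᶠ s in smalls X, b s ≠ 0 → a s ≠ 0) : IsCochain k W b := by
  obtain ⟨K, h1, h2, h3⟩ := ha
  refine ⟨K, h1, h2, ?_⟩
  filter_upwards [h3, h] with s h4 h5 h6
  exact h4 (h5 h6)

lemma IsCochain.restrict {k : ℕ} {W : Set X} {a : Coch X} (ha : IsCochain k W a)
    (P : Finset X → Prop) : IsCochain k W (fun s => if P s then a s else 0) :=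
  ha.of_imp (Eventually.of_forall fun s => by split_ifs <;> simp)

lemma IsCochain.add {k : ℕ} {U V : Set X} {a b : Coch X} (ha : IsCochain k U a)
    (hb : IsCochain k V b) : IsCochain k (U ∪ V) (a + b) := by
  obtain ⟨K, h1, h2, h3⟩ := ha
  obtain ⟨K', h1', h2', h3'⟩ := hb
  refine ⟨K ∪ K', h1.union h1', Set.union_subset_union h2 h2', ?_⟩
  filter_upwards [h3, h3'] with s h4 h5 h6
  by_cases h : a s = 0
  · have : b s ≠ 0 := fun h' => h6 (by simp [h, h'])
    exact ⟨(h5 this).1, (h5 this).2.1, (h5 this).2.2.trans Set.subset_union_right⟩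
  · exact ⟨(h4 h).1, (h4 h).2.1, (h4 h).2.2.trans Set.subset_union_left⟩

lemma IsCochain.add' {k : ℕ} {U : Set X} {a b : Coch X} (ha : IsCochain k U a)
    (hb : IsCochain k U b) : IsCochain k U (a + b) := by
  simpa using ha.add hb

lemma IsCochain.of_LZ {k : ℕ} {U : Set X} {a : Coch X} (h : LZ a) : IsCochain k U a := by
  refine ⟨∅, isCompact_empty, Set.empty_subset _, ?_⟩
  filter_upwards [h] with s hs h'
  exact absurd hs h'

lemma IsCochain.zero {k : ℕ} {U : Set X} : IsCochain k U (0 : Coch X) := .of_LZ .zero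

lemma IsCochain.congr {k : ℕ} {U : Set X} {a b : Coch X} (h : IsCochain k U a)
    (hab : LZ (a + b)) : IsCochain k U b := by
  refine h.of_imp ?_
  filter_upwards [hab] with s hs h1 h2
  exact h1 (by simpa [h2] using hs)

lemma IsCochain.LZ_of_zero {U : Set X} {a : Coch X} (h : IsCochain 0 U a) : LZ a := by
  obtain ⟨K, -, -, h⟩ := h
  filter_upwards [h] with s hs
  by_contra h1
  obtain ⟨h2, h3, -⟩ := hs h1
  rw [Finset.card_eq_zero] at h3
  exact h2.ne_empty h3

/-- A set that is within small distance of a compact subset of an open set. -/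
lemma IsCochain.of_near [ProperSpace X] {k : ℕ} {W K : Set X} (hK : IsCompact K) (hKW : K ⊆ W)
    (hW : IsOpen W) {a : Coch X}
    (h : ∀ η > 0, ∀ᶠ s in smalls X, a s ≠ 0 → s.Nonempty ∧ s.card = k ∧
      (s : Set X) ⊆ cthickening η K) : IsCochain k W a := by
  obtain ⟨η, hη, h'⟩ := hK.exists_cthickening_subset_open hW hKW
  exact ⟨_, hK.cthickening, h', h η hη⟩

lemma subset_cthickening_of_sm {η : ℝ} {s : Finset X} (hs : Sm η s) {K : Set X} {p : X}
    (hp : p ∈ s) (hpK : p ∈ K) : (s : Set X) ⊆ cthickening η K := fun q hq =>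
  mem_cthickening_of_dist_le q p η K hpK (hs q hq p hp).le

lemma IsCochain.cob [ProperSpace X] {k : ℕ} {W : Set X} (hW : IsOpen W) {a : Coch X}
    (ha : IsCochain k W a) : IsCochain (k + 1) W (cob a) := by
  obtain ⟨K, h1, h2, h3⟩ := ha
  refine .of_near h1 h2 hW fun η hη => ?_
  filter_upwards [eventually_subset h3, eventually_sm hη] with s h4 h5 h6
  obtain ⟨v, hv, t, hts, hc, hst, ht⟩ := cob_ne_zero h6
  obtain ⟨h7, h8, h9⟩ := h4 t hts ht
  refine ⟨⟨v, hv⟩, by omega, ?_⟩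
  obtain ⟨p, hp⟩ := h7
  exact subset_cthickening_of_sm h5 (hts hp) (h9 hp)

/-- Compactly supported cocycles of degree `k`. -/
def Coc (k : ℕ) (W : Set X) (a : Coch X) : Prop := IsCochain (k + 1) W a ∧ LZ (cob a)

/-- Compactly supported coboundaries of degree `k`. -/
def Bd (k : ℕ) (W : Set X) (a : Coch X) : Prop := ∃ b, IsCochain k W b ∧ LZ (a + cob b)

lemma Coc.mono {k : ℕ} {U W : Set X} (h : U ⊆ W) {a : Coch X} (ha : Coc k U a) : Coc k W a :=
  ⟨ha.1.mono h, ha.2⟩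

lemma Coc.add {k : ℕ} {U : Set X} {a b : Coch X} (ha : Coc k U a) (hb : Coc k U b) :
    Coc k U (a + b) :=
  ⟨ha.1.add' hb.1, by rw [cob_add]; exact ha.2.add hb.2⟩

lemma Coc.zero {k : ℕ} {U : Set X} : Coc k U (0 : Coch X) := ⟨.zero, LZ.zero.cob⟩

lemma Coc.congr {k : ℕ} {U : Set X} {a b : Coch X} (ha : Coc k U a) (h : LZ (a + b)) :
    Coc k U b := ⟨ha.1.congr h, ha.2.congr (by rw [← cob_add]; exact h.cob)⟩

lemma Bd.mono {k : ℕ} {U W : Set X} (h : U ⊆ W) {a : Coch X} (ha : Bd k U a) : Bd k W a := by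
  obtain ⟨b, h1, h2⟩ := ha
  exact ⟨b, h1.mono h, h2⟩

lemma Bd.add {k : ℕ} {U : Set X} {a b : Coch X} (ha : Bd k U a) (hb : Bd k U b) :
    Bd k U (a + b) := by
  obtain ⟨c, h1, h2⟩ := ha
  obtain ⟨d, h3, h4⟩ := hb
  refine ⟨c + d, h1.add' h3, ?_⟩
  rw [cob_add]
  convert h2.add h4 using 1
  abel

lemma Bd.of_LZ {k : ℕ} {U : Set X} {a : Coch X} (h : LZ a) : Bd k U a :=
  ⟨0, .zero, h.add LZ.zero.cob⟩

lemma Bd.congr {k : ℕ} {U : Set X} {a b : Coch X} (ha : Bd k U a) (h : LZ (a + b)) :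
    Bd k U b := by
  obtain ⟨c, h1, h2⟩ := ha
  refine ⟨c, h1, h.congr ?_⟩
  convert h2 using 1
  funext s
  simp only [Pi.add_apply]
  grind

lemma Bd.of_add {k : ℕ} {U : Set X} {a b : Coch X} (ha : Bd k U a) (h : Bd k U (a + b)) :
    Bd k U b := by
  convert ha.add h using 1
  funext s
  simp only [Pi.add_apply]
  grind

lemma Bd.cob {k : ℕ} {U : Set X} {a : Coch X} (h : IsCochain k U a) : Bd k U (cob a) :=
  ⟨a, h, Eventually.of_forall fun _ => ZModModule.add_self _⟩

lemma Coc.cob [ProperSpace X] {k : ℕ} {U : Set X} (hU : IsOpen U) {a : Coch X}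
    (h : IsCochain k U a) : Coc k U (cob a) :=
  ⟨h.cob hU, by rw [cob_cob]; exact .zero⟩

/-! #### Covers of bounded multiplicity -/

/-- `K` has a finite cover by compact sets of diameter less than `ε` no `m + 1` of which have
a common point. -/
def HasCover (m : ℕ) (K : Set X) (ε : ℝ) : Prop :=
  ∃ (N : ℕ) (V : Fin N → Set X), (∀ i, IsCompact (V i)) ∧ K ⊆ ⋃ i, V i ∧
    (∀ i, ∀ p ∈ V i, ∀ q ∈ V i, dist p q < ε) ∧
    ∀ p, (Finset.univ.filter fun i => p ∈ V i).card ≤ m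

lemma exists_pos_of_iInter_empty {N : ℕ} {V : Fin N → Set X} (hV : ∀ i, IsCompact (V i))
    (J : Finset (Fin N)) (hJ : ∀ p, ∃ i ∈ J, p ∉ V i) :
    ∃ τ > 0, ∀ p, ∃ i ∈ J, ∀ q ∈ V i, τ ≤ dist p q := by
  by_cases he : ∃ i ∈ J, V i = ∅
  · obtain ⟨i, hi, h⟩ := he
    exact ⟨1, one_pos, fun p => ⟨i, hi, by simp [h]⟩⟩
  push Not at he
  rcases J.eq_empty_or_nonempty with rfl | ⟨j, hj⟩
  · refine ⟨1, one_pos, fun p => ?_⟩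
    obtain ⟨i, hi, -⟩ := hJ p
    simp at hi
  let g : X → ℝ := fun p => ∑ i ∈ J, infDist p (V i)
  have hg : Continuous g := continuous_finsetSum _ fun i _ => continuous_infDist_pt _
  obtain ⟨p₀, hp₀, hmin⟩ := (hV j).exists_isMinOn (he j hj) hg.continuousOn
  have hpos : 0 < g p₀ := by
    obtain ⟨i, hi, h⟩ := hJ p₀
    refine Finset.sum_pos' (fun _ _ => infDist_nonneg) ⟨i, hi, ?_⟩
    exact ((hV i).isClosed.notMem_iff_infDist_pos (he i hi)).1 h
  have hJc : (0 : ℝ) < 2 * J.card + 1 := by positivity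
  refine ⟨g p₀ / (2 * J.card + 1), by positivity, fun p => ?_⟩
  by_contra! hc
  obtain ⟨q, hq, hpq⟩ := hc j hj
  have h1 : g p₀ ≤ g q := hmin hq
  have h2 : g q ≤ ∑ i ∈ J, 2 * (g p₀ / (2 * J.card + 1)) := by
    refine Finset.sum_le_sum fun i hi => ?_
    obtain ⟨q', hq', hpq'⟩ := hc i hi
    have := infDist_le_dist_of_mem (x := q) hq'
    have := dist_triangle_left q q' p
    linarith
  have h3 : ∑ i ∈ J, 2 * (g p₀ / (2 * J.card + 1)) = g p₀ * (2 * J.card / (2 * J.card + 1)) := by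
    rw [Finset.sum_const, nsmul_eq_mul]; field_simp
  have h4 : (2 * J.card / (2 * J.card + 1) : ℝ) < 1 := by
    rw [div_lt_one hJc]; linarith
  nlinarith

/-- A cover of multiplicity at most `m` gives a map onto its nerve, collapsing small simplices
to sets with at most `m` points. -/
lemma exists_collapse {m : ℕ} {K : Set X} {ε : ℝ} (hε : 0 < ε) (h : HasCover m K ε) :
    ∃ τ > 0, ∃ f : X → X, (∀ p, dist p (f p) < 2 * ε) ∧
      ∀ s : Finset X, (s : Set X) ⊆ thickening τ K → Sm τ s → (s.image f).card ≤ m := by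
  obtain ⟨N, V, hV, hK, hd, hm⟩ := h
  have hτ : ∃ τ > 0, ∀ J : Finset (Fin N), m < J.card →
      ∀ p, ∃ i ∈ J, ∀ q ∈ V i, τ ≤ dist p q := by
    have : ∀ J : Finset (Fin N), ∃ τ > 0, m < J.card → ∀ p, ∃ i ∈ J, ∀ q ∈ V i, τ ≤ dist p q := by
      intro J
      by_cases hJ : m < J.card
      · obtain ⟨τ, h1, h2⟩ := exists_pos_of_iInter_empty hV J (by
          intro p
          by_contra! hc
          have := (Finset.card_le_card (show J ⊆ Finset.univ.filter fun i => p ∈ V i from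
            fun i hi => by simpa using hc i hi)).trans (hm p)
          omega)
        exact ⟨τ, h1, fun _ => h2⟩
      · exact ⟨1, one_pos, fun h => absurd h hJ⟩
    choose τ h1 h2 using this
    obtain ⟨J₀, -, h⟩ := Finset.exists_min_image Finset.univ τ ⟨∅, Finset.mem_univ _⟩
    exact ⟨τ J₀, h1 J₀, fun J hJ p => (h2 J hJ p).imp fun i hi => ⟨hi.1, fun q hq =>
      (h J (Finset.mem_univ _)).trans (hi.2 q hq)⟩⟩
  obtain ⟨τ, hτ, hJ⟩ := hτ
  set σ := min ε (τ / 2) with hσ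
  have hσ0 : 0 < σ := lt_min hε (by positivity)
  have hσε : σ ≤ ε := min_le_left _ _
  have hστ : σ ≤ τ / 2 := min_le_right _ _
  let v : Fin N → X → X := fun i p => if h : (V i).Nonempty then h.some else p
  let l : X → Option (Fin N) := fun p =>
    if h : ∃ i, ∃ q ∈ V i, dist p q < σ then some h.choose else none
  have hl : ∀ p i, l p = some i → ∃ q ∈ V i, dist p q < σ := by
    intro p i h
    simp only [l] at h
    split_ifs at h with h'
    · cases h
      exact h'.choose_spec
  refine ⟨σ, hσ0, fun p => (l p).elim p fun i => v i p, fun p => ?_, fun s hs hsm => ?_⟩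
  · cases h : l p with
    | none =>
      have h2 : dist p p < 2 * ε := by rw [dist_self]; positivity
      simp only [h]
      exact h2
    | some i =>
      obtain ⟨q, hq, hpq⟩ := hl p i h
      have hne : (V i).Nonempty := ⟨q, hq⟩
      have h2 : v i p ∈ V i := by simp only [v]; rw [dif_pos hne]; exact hne.some_mem
      have h3 := hd i q hq _ h2
      have h4 := dist_triangle p q (v i p)
      have h5 : dist p (v i p) < 2 * ε := by linarith
      simp only [h]
      exact h5
  · have hlab : ∀ p ∈ s, ∃ i, l p = some i := by
      intro p hp
      obtain ⟨q, hq, hpq⟩ := mem_thickening_iff.1 (hs hp)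
      obtain ⟨i, hi⟩ := Set.mem_iUnion.1 (hK hq)
      have : ∃ i, ∃ q ∈ V i, dist p q < σ := ⟨i, q, hi, hpq⟩
      exact ⟨_, dif_pos this⟩
    rcases s.eq_empty_or_nonempty with rfl | ⟨p₀, hp₀⟩
    · simp
    set J : Finset (Fin N) := Finset.univ.filter fun i => ∃ p ∈ s, l p = some i with hJdef
    have hJm : J.card ≤ m := by
      by_contra! hc
      obtain ⟨i, hi, h⟩ := hJ J hc p₀
      simp only [hJdef, Finset.mem_filter, Finset.mem_univ, true_and] at hi
      obtain ⟨p, hp, hpi⟩ := hi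
      obtain ⟨q, hq, hpq⟩ := hl p i hpi
      have := h q hq
      have := hsm p₀ hp₀ p hp
      have := dist_triangle p₀ p q
      linarith
    refine le_trans ?_ hJm
    refine (Finset.card_le_card (t := J.image fun i => v i p₀) ?_).trans Finset.card_image_le
    intro y hy
    obtain ⟨p, hp, rfl⟩ := Finset.mem_image.1 hy
    obtain ⟨i, hi⟩ := hlab p hp
    refine Finset.mem_image.2 ⟨i, by simp only [hJdef, Finset.mem_filter, Finset.mem_univ, true_and]; exact ⟨p, hp, hi⟩, ?_⟩
    obtain ⟨q, hq, -⟩ := hl p i hi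
    have hne : (V i).Nonempty := ⟨q, hq⟩
    simp only [hi, Option.elim, v]
    rw [dif_pos hne, dif_pos hne]

/-- In degrees at least the covering dimension every cocycle is a coboundary. -/
lemma bd_of_hasCover [ProperSpace X] {n k : ℕ} (hk : n + 1 ≤ k) {W : Set X} (hW : IsOpen W)
    (hc : ∀ K ⊆ W, IsCompact K → ∀ ε > 0, HasCover (n + 1) K ε) {a : Coch X} (ha : Coc k W a) :
    Bd k W a := by
  obtain ⟨⟨K, hK, hKW, h⟩, hz⟩ := ha
  obtain ⟨η, hη, hηW⟩ := hK.exists_cthickening_subset_open hW hKW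
  obtain ⟨ε₀, hε₀, h0⟩ := eventually_smalls.1 (h.and hz)
  have hε : 0 < min η ε₀ / 8 := by positivity
  set ε := min η ε₀ / 8 with hεdef
  have h1 : 8 * ε ≤ η := by rw [hεdef]; linarith [min_le_left η ε₀]
  have h2 : 8 * ε ≤ ε₀ := by rw [hεdef]; linarith [min_le_right η ε₀]
  obtain ⟨τ, hτ, f, hf, hcard⟩ := exists_collapse hε (hc _ hηW hK.cthickening ε hε)
  obtain ⟨T, hT, hTs⟩ := exists_homotopy (id : X → X) f
  have hsm : ∀ s t : Finset X, Sm ε s → (t : Set X) ⊆ id '' (s : Set X) ∪ f '' s →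
      ∀ q ∈ t, ∀ p ∈ s, dist p q < 3 * ε := by
    intro s t hs ht q hq p hp
    rcases ht hq with ⟨q, hq', rfl⟩ | ⟨q, hq', rfl⟩
    · exact (hs p hp q hq').trans (by linarith)
    · have := hs p hp q hq'
      have := hf q
      have := dist_triangle p q (f q)
      linarith
  have hsm' : ∀ s t : Finset X, Sm ε s → s.Nonempty →
      (t : Set X) ⊆ id '' (s : Set X) ∪ f '' s → Sm ε₀ t := by
    rintro s t hs ⟨p, hp⟩ ht q hq q' hq'
    have := hsm s t hs ht q hq p hp
    have := hsm s t hs ht q' hq' p hp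
    have := dist_triangle_left q q' p
    linarith
  have hempty : ∀ a : Coch X, ∀ s t : Finset X, (t : Set X) ⊆ id '' (s : Set X) ∪ f '' s →
      t.card = s.card + 1 → s.Nonempty := by
    intro a s t ht hc
    by_contra hs
    rw [Finset.not_nonempty_iff_eq_empty] at hs
    subst hs
    simp at ht
    simp [ht] at hc
  refine ⟨T a, ⟨_, hK.cthickening, hηW, ?_⟩, ?_⟩
  · filter_upwards [eventually_sm hε] with s hs hne
    obtain ⟨t, ht, hc, hat⟩ := hTs a s hne
    have hsn := hempty a s t ht hc
    obtain ⟨h3, h4, h5⟩ := (h0 t (hsm' s t hs hsn ht)).1 hat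
    refine ⟨hsn, by omega, fun p hp => ?_⟩
    obtain ⟨q, hq⟩ := h3
    exact mem_cthickening_of_dist_le _ q _ _ (h5 hq) (by linarith [hsm s t hs ht q hq p hp])
  · filter_upwards [eventually_sm hε, eventually_sm hτ] with s hs hsτ
    have e := congrFun (hT a) s
    rw [pull_id] at e
    simp only [Pi.add_apply] at e ⊢
    have e1 : T (SmallSimplices.cob a) s = 0 := by
      by_contra hne
      obtain ⟨t, ht, hc, hat⟩ := hTs _ s hne
      exact hat (h0 t (hsm' s t hs (hempty a s t ht hc) ht)).2
    have e2 : pull f a s = 0 := by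
      by_contra hne
      obtain ⟨t, ht, hc, hat⟩ := pull_ne_zero hne
      have ht' : (t : Set X) ⊆ id '' (s : Set X) ∪ f '' s := ht ▸ Set.subset_union_right
      have hsn : s.Nonempty := by
        by_contra hs
        rw [Finset.not_nonempty_iff_eq_empty] at hs
        subst hs
        simp at ht
        subst ht
        exact ((h0 ∅ (by intro p hp; simp at hp)).1 hat).1.ne_empty rfl
      obtain ⟨h3, h4, h5⟩ := (h0 t (hsm' s t hs hsn ht')).1 hat
      have h6 : (s : Set X) ⊆ thickening τ (cthickening η K) := by
        refine Set.Subset.trans (fun p hp => ?_) (self_subset_thickening hτ _)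
        obtain ⟨q, hq⟩ := h3
        exact mem_cthickening_of_dist_le _ q _ _ (h5 hq)
          (by linarith [hsm s t hs ht' q hq p hp])
      have h7 := hcard s h6 hsτ
      have h8 : t = s.image f := by
        rw [← Finset.coe_inj, ht, Finset.coe_image]
      rw [← h8, h4] at h7
      omega
    rw [e1, e2] at e
    grind

end Germs

end SmallSimplices

/-! ### Covers of small multiplicity from estimates of Hausdorff measure -/

namespace SmallSimplices

open Set
open scoped ENNReal

section Nets

variable {X : Type*} [MetricSpace X]

lemma hasCover_of_radii {S : Set X} (hS : IsCompact S) {N m : ℕ} (z : Fin N → X) {δ : ℝ}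
    (hδ : 0 < δ) (hz : S ⊆ ⋃ i, ball (z i) δ) (ρ : Fin N → ℝ) (hρ : ∀ i, ρ i ∈ Icc δ (2 * δ))
    (h : ∀ t : Fin m ↪ Fin N, ∀ p ∈ S, ∃ k, dist p (z (t k)) ≠ ρ (t k)) :
    HasCover m S (5 * δ) := by
  classical
  refine ⟨N, fun i => S ∩ (closedBall (z i) (ρ i) \ ⋃ j, ⋃ (_ : j < i), ball (z j) (ρ j)),
    fun i => ?_, fun p hp => ?_, fun i p hp q hq => ?_, fun p => ?_⟩
  · refine hS.inter_right (isClosed_closedBall.sdiff ?_)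
    exact isOpen_iUnion fun j => isOpen_iUnion fun _ => isOpen_ball
  · have hex : (Finset.univ.filter fun i => p ∈ closedBall (z i) (ρ i)).Nonempty := by
      obtain ⟨i, hi⟩ := mem_iUnion.1 (hz hp)
      refine ⟨i, by simpa using (mem_ball.1 hi).le.trans (hρ i).1⟩
    obtain ⟨i, hi, hmin⟩ := Finset.exists_min_image _ id hex
    refine mem_iUnion.2 ⟨i, hp, by simpa using hi, ?_⟩
    simp only [mem_iUnion, not_exists]
    intro j hj hpj
    exact absurd hj (not_lt.2 (hmin j (by simpa using (mem_ball.1 hpj).le)))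
  · have h1 := hp.2.1
    have h2 := hq.2.1
    rw [mem_closedBall] at h1 h2
    have := dist_triangle_right p q (z i)
    linarith [(hρ i).2]
  · by_contra! hcard
    set F := Finset.univ.filter fun i =>
      p ∈ S ∩ (closedBall (z i) (ρ i) \ ⋃ j, ⋃ (_ : j < i), ball (z j) (ρ j)) with hF
    have hmem : ∀ i ∈ F, p ∈ S ∩ (closedBall (z i) (ρ i) \ ⋃ j, ⋃ (_ : j < i), ball (z j) (ρ j)) :=
      fun i hi => (Finset.mem_filter.1 hi).2
    obtain ⟨i₀, hi₀, hmax⟩ := Finset.exists_max_image F id (Finset.card_pos.1 (by omega))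
    obtain ⟨G, hG, hGm⟩ := Finset.exists_subset_card_eq (s := F.erase i₀) (n := m) (by
      rw [Finset.card_erase_of_mem hi₀]; omega)
    obtain ⟨k, hk⟩ := h (G.orderEmbOfFin hGm).toEmbedding p (hmem _ hi₀).1
    have hkG := hG (G.orderEmbOfFin_mem hGm k)
    obtain ⟨hk1, hk2⟩ := Finset.mem_erase.1 hkG
    refine hk (le_antisymm (hmem _ hk2).2.1 ?_)
    by_contra! hlt
    exact (hmem _ hi₀).2.2 (mem_iUnion₂.2 ⟨_, lt_of_le_of_ne (hmax _ hk2) hk1, hlt⟩)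

lemma exists_separated_subset (s : Finset X) (ε : ℝ) : ∃ A ⊆ s,
    (∀ a ∈ A, ∀ b ∈ A, a ≠ b → ε ≤ dist a b) ∧ ∀ p ∈ s, ∃ a ∈ A, p = a ∨ dist p a < ε := by
  classical
  obtain ⟨A, hA, hmax⟩ := Finset.exists_max_image
    (s.powerset.filter fun A => ∀ a ∈ A, ∀ b ∈ A, a ≠ b → ε ≤ dist a b) Finset.card
    ⟨∅, by simp⟩
  simp only [Finset.mem_filter, Finset.mem_powerset] at hA hmax
  refine ⟨A, hA.1, hA.2, fun p hp => ?_⟩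
  by_contra! hc
  have hpA : p ∉ A := fun h => (hc p h).1 rfl
  have := hmax (insert p A) ⟨Finset.insert_subset hp hA.1, by
    intro a ha b hb hab
    rw [Finset.mem_insert] at ha hb
    rcases ha with rfl | ha <;> rcases hb with rfl | hb
    · exact absurd rfl hab
    · exact (hc b hb).2
    · rw [dist_comm]; exact (hc a ha).2
    · exact hA.2 a ha b hb hab⟩
  rw [Finset.card_insert_of_notMem hpA] at this
  omega

lemma card_le_of_doubling {D : ℕ} (hX : IsDoubling D X) (j : ℕ) : ∀ (z : X) (r : ℝ), 0 < r →
    ∀ s : Finset X, (s : Set X) ⊆ ball z r →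
    (∀ a ∈ s, ∀ b ∈ s, a ≠ b → r / 2 ^ j ≤ dist a b) → s.card ≤ D ^ (j + 1) := by
  classical
  induction j with
  | zero =>
    intro z r hr s hs h
    rw [zero_add, pow_one]
    exact hX z r s hs fun a ha b hb hab => (by linarith [h a ha b hb hab])
  | succ j ih =>
    intro z r hr s hs h
    obtain ⟨A, hAs, hA, hcov⟩ := exists_separated_subset s (r / 2)
    have hAD : A.card ≤ D := hX z r A ((Finset.coe_subset.2 hAs).trans hs) hA
    have hsub : s ⊆ A.biUnion fun a => s.filter fun p => dist p a < r / 2 := by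
      intro p hp
      obtain ⟨a, ha, h'⟩ := hcov p hp
      refine Finset.mem_biUnion.2 ⟨a, ha, Finset.mem_filter.2 ⟨hp, ?_⟩⟩
      rcases h' with rfl | h'
      · rw [dist_self]; positivity
      · exact h'
    calc s.card ≤ A.card * D ^ (j + 1) := (Finset.card_le_card hsub).trans
          (Finset.card_biUnion_le_card_mul _ _ _ fun a ha => by
            refine ih a (r / 2) (by positivity) _ ?_ ?_
            · intro p hp
              exact (Finset.mem_filter.1 (Finset.mem_coe.1 hp)).2
            · intro p hp q hq hpq
              have := h p (Finset.mem_filter.1 hp).1 q (Finset.mem_filter.1 hq).1 hpq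
              rw [div_div, ← pow_succ']
              exact this)
      _ ≤ D * D ^ (j + 1) := Nat.mul_le_mul_right _ hAD
      _ = D ^ (j + 1 + 1) := by ring

lemma exists_net_of_doubling {D : ℕ} (hX : IsDoubling D X) {S : Set X}
    (hS : Bornology.IsBounded S) {δ : ℝ} (hδ : 0 < δ) : ∃ A : Finset X,
    (∀ a ∈ A, ∀ b ∈ A, a ≠ b → δ ≤ dist a b) ∧ S ⊆ ⋃ a ∈ A, ball a δ := by
  classical
  rcases S.eq_empty_or_nonempty with rfl | ⟨z, hz⟩
  · exact ⟨∅, by simp, by simp⟩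
  obtain ⟨R, hR⟩ := hS.subset_ball z
  obtain ⟨j, hj⟩ := pow_unbounded_of_one_lt (R / δ) (one_lt_two (α := ℝ))
  have hR' : S ⊆ ball z (2 ^ j * δ) := hR.trans (ball_subset_ball (by
    rw [div_lt_iff₀ hδ] at hj; exact hj.le))
  let P : ℕ → Prop := fun k => ∃ A : Finset X, (A : Set X) ⊆ S ∧
    (∀ a ∈ A, ∀ b ∈ A, a ≠ b → δ ≤ dist a b) ∧ A.card = k
  have hP : ∀ k, P k → k ≤ D ^ (j + 1) := by
    rintro k ⟨A, h1, h2, rfl⟩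
    refine card_le_of_doubling hX j z (2 ^ j * δ) (by positivity) A (h1.trans hR') ?_
    intro a ha b hb hab
    rw [mul_div_cancel_left₀ _ (by positivity)]
    exact h2 a ha b hb hab
  obtain ⟨A, h1, h2, h3⟩ : P (Nat.findGreatest P (D ^ (j + 1))) :=
    Nat.findGreatest_spec (Nat.zero_le _) ⟨∅, by simp, by simp, rfl⟩
  refine ⟨A, h2, fun p hp => ?_⟩
  by_contra hc
  simp only [mem_iUnion, mem_ball, not_exists, not_lt] at hc
  have hpA : p ∉ A := fun h => absurd (hc p h) (by simpa using hδ)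
  have hP' : P (A.card + 1) := ⟨insert p A, by
      rw [Finset.coe_insert]; exact insert_subset hp h1, by
      intro a ha b hb hab
      rw [Finset.mem_insert] at ha hb
      rcases ha with rfl | ha <;> rcases hb with rfl | hb
      · exact absurd rfl hab
      · exact hc b hb
      · rw [dist_comm]; exact hc a ha
      · exact h2 a ha b hb hab, Finset.card_insert_of_notMem hpA⟩
  have := Nat.le_findGreatest (hP _ hP') hP'
  omega

end Nets

section Radii

variable {X : Type*} [MetricSpace X] [MeasurableSpace X] [BorelSpace X]

lemma pi_map_comp {ι κ : Type*} [Fintype ι] [Fintype κ] (ν : Measure ℝ) [IsProbabilityMeasure ν]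
    (t : κ ↪ ι) :
    (Measure.pi fun _ : ι => ν).map (fun ρ k => ρ (t k)) = Measure.pi fun _ : κ => ν := by
  classical
  symm
  refine Measure.pi_eq fun s hs => ?_
  rw [Measure.map_apply (by fun_prop) (MeasurableSet.univ_pi hs)]
  let u : ι → Set ℝ := fun i => if h : ∃ k, t k = i then s h.choose else univ
  have hu : ∀ k, u (t k) = s k := by
    intro k
    have h : ∃ k', t k' = t k := ⟨k, rfl⟩
    simp only [u]
    rw [dif_pos h, t.injective h.choose_spec]
  have h1 : (fun (ρ : ι → ℝ) (k : κ) => ρ (t k)) ⁻¹' univ.pi s = univ.pi u := by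
    ext ρ
    simp only [mem_preimage, mem_univ_pi]
    constructor
    · intro h i
      by_cases hi : ∃ k, t k = i
      · obtain ⟨k, rfl⟩ := hi
        rw [hu]; exact h k
      · simp only [u]; rw [dif_neg hi]; trivial
    · intro h k
      rw [← hu]; exact h _
  rw [h1, Measure.pi_pi, ← Finset.prod_subset (Finset.subset_univ (Finset.univ.map t)),
    Finset.prod_map]
  · simp [hu]
  · intro i _ hi
    have : ¬ ∃ k, t k = i := by simpa using hi
    simp only [u]; rw [dif_neg this, measure_univ]

lemma exists_radii {S : Set X} (hS : IsCompact S) {N m : ℕ} (z : Fin N → X) {δ : ℝ} (hδ : 0 < δ)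
    (h : ∑ t : Fin m ↪ Fin N, μH[m] (S ∩ ⋂ k, closedBall (z (t k)) (2 * δ)) <
      ENNReal.ofReal (δ ^ m)) :
    ∃ ρ : Fin N → ℝ, (∀ i, ρ i ∈ Icc δ (2 * δ)) ∧
      ∀ t : Fin m ↪ Fin N, ∀ p ∈ S, ∃ k, dist p (z (t k)) ≠ ρ (t k) := by
  let c : ℝ≥0∞ := ENNReal.ofReal δ⁻¹
  let ν : Measure ℝ := c • volume.restrict (Icc δ (2 * δ))
  have hc : c * ENNReal.ofReal δ = 1 := by
    rw [← ENNReal.ofReal_mul (by positivity), inv_mul_cancel₀ hδ.ne', ENNReal.ofReal_one]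
  have hν : IsProbabilityMeasure ν := ⟨by
    simp only [ν, Measure.smul_apply, Measure.restrict_apply MeasurableSet.univ, univ_inter,
      Real.volume_Icc, smul_eq_mul]
    rw [show 2 * δ - δ = δ by ring, hc]⟩
  have hpi : Measure.pi (fun _ : Fin m => ν) ≤ c ^ m • (volume : Measure (Fin m → ℝ)) := by
    have : Measure.pi (fun _ : Fin m => ν) =
        c ^ m • (volume : Measure (Fin m → ℝ)).restrict (univ.pi fun _ => Icc δ (2 * δ)) := by
      refine Measure.pi_eq fun s hs => ?_
      rw [Measure.smul_apply, volume_pi, Measure.restrict_pi_pi, Measure.pi_pi]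
      simp [ν, Finset.prod_mul_distrib]
    rw [this]
    gcongr
    exact Measure.restrict_le_self
  let E : (Fin m ↪ Fin N) → Set (Fin m → ℝ) := fun t =>
    (fun p k => dist p (z (t k))) '' (S ∩ ⋂ k, closedBall (z (t k)) (2 * δ))
  have hEm : ∀ t, MeasurableSet (E t) := fun t => by
    refine (IsCompact.image (hS.inter_right ?_) (by fun_prop)).isClosed.measurableSet
    exact isClosed_iInter fun k => isClosed_closedBall
  have hE : ∀ t, volume (E t) ≤ μH[m] (S ∩ ⋂ k, closedBall (z (t k)) (2 * δ)) := fun t => by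
    have hl : LipschitzWith 1 (fun (p : X) (k : Fin m) => dist p (z (t k))) :=
      LipschitzWith.of_dist_le_mul fun p q => by
        rw [NNReal.coe_one, one_mul, dist_pi_le_iff dist_nonneg]
        exact fun k => dist_dist_dist_le_left p q _
    have := hl.hausdorffMeasure_image_le (d := m) (by positivity)
      (S ∩ ⋂ k, closedBall (z (t k)) (2 * δ))
    rw [← hausdorffMeasure_pi_real]
    simpa [E] using this
  let bad : Set (Fin N → ℝ) := ⋃ t, (fun ρ k => ρ (t k)) ⁻¹' E t
  have hbad : Measure.pi (fun _ : Fin N => ν) bad < 1 := by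
    calc _ ≤ ∑ t, Measure.pi (fun _ : Fin N => ν) ((fun ρ k => ρ (t k)) ⁻¹' E t) :=
          measure_iUnion_fintype_le _ _
      _ = ∑ t, Measure.pi (fun _ : Fin m => ν) (E t) := by
          refine Finset.sum_congr rfl fun t _ => ?_
          rw [← pi_map_comp ν t, Measure.map_apply (by fun_prop) (hEm t)]
      _ ≤ ∑ t : Fin m ↪ Fin N, c ^ m * μH[m] (S ∩ ⋂ k, closedBall (z (t k)) (2 * δ)) := by
          refine Finset.sum_le_sum fun t _ => (hpi _).trans ?_
          rw [Measure.smul_apply, smul_eq_mul]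
          gcongr
          exact hE t
      _ = c ^ m * ∑ t : Fin m ↪ Fin N, μH[m] (S ∩ ⋂ k, closedBall (z (t k)) (2 * δ)) := by
          rw [Finset.mul_sum]
      _ < c ^ m * ENNReal.ofReal (δ ^ m) := by
          have hc0 : c ≠ 0 := by
            intro h0; rw [h0, zero_mul] at hc; exact zero_ne_one hc
          exact ENNReal.mul_lt_mul_right (pow_ne_zero _ hc0)
            (ENNReal.pow_ne_top ENNReal.ofReal_ne_top) h
      _ = 1 := by
          rw [ENNReal.ofReal_pow hδ.le, ← mul_pow, hc, one_pow]
  have hbox : Measure.pi (fun _ : Fin N => ν) (univ.pi fun _ => Icc δ (2 * δ))ᶜ = 0 := by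
    rw [prob_compl_eq_zero_iff (MeasurableSet.univ_pi fun _ => measurableSet_Icc), Measure.pi_pi]
    refine Finset.prod_eq_one fun i _ => ?_
    simp only [ν, Measure.smul_apply, Measure.restrict_apply_self, Real.volume_Icc, smul_eq_mul]
    rw [show 2 * δ - δ = δ by ring, hc]
  have hne : ∃ ρ, ρ ∉ bad ∪ (univ.pi fun _ : Fin N => Icc δ (2 * δ))ᶜ := by
    by_contra! hall
    have h1 : Measure.pi (fun _ : Fin N => ν) univ ≤ _ :=
      (measure_mono fun ρ _ => hall ρ).trans (measure_union_le _ _)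
    rw [hbox, add_zero, measure_univ] at h1
    exact absurd hbad (not_lt.2 h1)
  obtain ⟨ρ, hρ⟩ := hne
  simp only [mem_union, not_or, mem_compl_iff, not_not, mem_univ_pi] at hρ
  refine ⟨ρ, hρ.2, fun t p hp => ?_⟩
  by_contra! hall
  refine hρ.1 (mem_iUnion.2 ⟨t, p, ⟨hp, mem_iInter.2 fun k => ?_⟩, funext hall⟩)
  rw [mem_closedBall, hall]
  exact (hρ.2 _).2

/-- Compact sets of vanishing `m`-dimensional measure have fine covers of multiplicity `m`. -/
lemma hasCover_of_measure_zero {S : Set X} (hS : IsCompact S) {m : ℕ} (h : μH[m] S = 0)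
    {ε : ℝ} (hε : 0 < ε) : HasCover m S ε := by
  have hδ : 0 < ε / 5 := by positivity
  obtain ⟨t, -, htf, hcov⟩ := hS.finite_cover_balls hδ
  obtain ⟨N, z, -, hz⟩ := htf.fin_param
  have hcov' : S ⊆ ⋃ i, ball (z i) (ε / 5) := by
    rw [← hz, biUnion_range] at hcov
    exact hcov
  obtain ⟨ρ, h1, h2⟩ := exists_radii hS (m := m) z hδ (by
    rw [Finset.sum_eq_zero fun t _ => measure_mono_null inter_subset_left h]
    exact ENNReal.ofReal_pos.2 (by positivity))
  have := hasCover_of_radii hS z hδ hcov' ρ h1 h2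
  rwa [mul_div_cancel₀ _ (by norm_num)] at this

/-- In a doubling space, sets of small measure have covers of small multiplicity. -/
lemma hasCover_of_doubling {D : ℕ} (hX : IsDoubling D X) {S : Set X} (hS : IsCompact S) {m : ℕ}
    {δ : ℝ} (hδ : 0 < δ) (h : ((D ^ 3) ^ m : ℕ) * μH[m] S < ENNReal.ofReal (δ ^ m)) :
    HasCover m S (5 * δ) := by
  classical
  obtain ⟨A, hA, hcov⟩ := exists_net_of_doubling hX hS.isBounded hδ
  let e := A.equivFin
  let z : Fin A.card → X := fun i => e.symm i
  have hzi : Function.Injective z := Subtype.val_injective.comp e.symm.injective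
  have hz : S ⊆ ⋃ i, ball (z i) δ := fun p hp => by
    obtain ⟨a, ha, hpa⟩ := mem_iUnion₂.1 (hcov hp)
    exact mem_iUnion.2 ⟨e ⟨a, ha⟩, by simpa [z] using hpa⟩
  have hcount : ∀ p : X, (Finset.univ.filter fun t : Fin m ↪ Fin A.card =>
      p ∈ ⋂ k, closedBall (z (t k)) (2 * δ)).card ≤ (D ^ 3) ^ m := by
    intro p
    set F := Finset.univ.filter fun i => p ∈ closedBall (z i) (2 * δ) with hF
    have hFc : F.card ≤ D ^ 3 := by
      rw [← Finset.card_map ⟨z, hzi⟩]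
      refine card_le_of_doubling hX 2 p (4 * δ) (by positivity) _ ?_ ?_
      · intro q hq
        rw [Finset.mem_coe, Finset.mem_map] at hq
        obtain ⟨i, hi, rfl⟩ := hq
        have h1 := mem_closedBall'.1 (Finset.mem_filter.1 hi).2
        exact mem_ball.2 (h1.trans_lt (by linarith))
      · intro a ha b hb hab
        rw [Finset.mem_map] at ha hb
        obtain ⟨i, -, rfl⟩ := ha
        obtain ⟨k, -, rfl⟩ := hb
        have := hA _ (e.symm i).2 _ (e.symm k).2 hab
        refine le_trans (by linarith) this
    calc _ ≤ (Fintype.piFinset fun _ : Fin m => F).card := by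
          refine Finset.card_le_card_of_injOn (fun t => t) ?_ (DFunLike.coe_injective.injOn)
          intro t ht
          rw [Finset.mem_coe, Finset.mem_filter] at ht
          rw [Finset.mem_coe, Fintype.mem_piFinset]
          exact fun k => Finset.mem_filter.2 ⟨Finset.mem_univ _, mem_iInter.1 ht.2 k⟩
      _ = F.card ^ m := by rw [Fintype.card_piFinset]; simp
      _ ≤ _ := Nat.pow_le_pow_left hFc m
  have hmeas : ∀ t : Fin m ↪ Fin A.card,
      MeasurableSet (⋂ k, closedBall (z (t k)) (2 * δ)) := fun t =>
    MeasurableSet.iInter fun k => measurableSet_closedBall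
  suffices hle : _ ≤ _ by
    obtain ⟨ρ, h1, h2⟩ := exists_radii hS (m := m) z hδ (lt_of_le_of_lt hle h)
    exact hasCover_of_radii hS z hδ hz ρ h1 h2
  calc ∑ t : Fin m ↪ Fin A.card, μH[m] (S ∩ ⋂ k, closedBall (z (t k)) (2 * δ))
      = ∑ t : Fin m ↪ Fin A.card, ∫⁻ p in S,
          (⋂ k, closedBall (z (t k)) (2 * δ)).indicator 1 p ∂μH[m] := by
        refine Finset.sum_congr rfl fun t _ => ?_
        rw [lintegral_indicator_one (hmeas t), Measure.restrict_apply (hmeas t), inter_comm]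
    _ = ∫⁻ p in S, ∑ t : Fin m ↪ Fin A.card,
          (⋂ k, closedBall (z (t k)) (2 * δ)).indicator 1 p ∂μH[m] := by
        rw [lintegral_finsetSum]
        exact fun t _ => measurable_one.indicator (hmeas t)
    _ ≤ ∫⁻ p in S, (((D ^ 3) ^ m : ℕ) : ℝ≥0∞) ∂μH[m] := by
        refine lintegral_mono fun p => ?_
        simp only [indicator_apply, Pi.one_apply, Finset.sum_boole]
        exact_mod_cast hcount p
    _ = _ := by rw [setLIntegral_const]

end Radii

end SmallSimplices

/-! ### Sets that look like Euclidean space in the top degree -/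

namespace SmallSimplices

open Filter Topology

section Transport

open scoped Classical

variable {X M : Type*} [MetricSpace X] [MetricSpace M]

/-- The part of the local theory of a Euclidean open set `b` that is used: there is at most one
nonzero class in degree `n`, it is supported in arbitrarily small sets near any given point, and
the covering dimension is at most `n`. -/
structure Good (n : ℕ) (b : Set M) : Prop where
  isOpen : IsOpen b
  unique : ∀ a a', Coc n b a → Coc n b a' → Bd n b a ∨ Bd n b a' ∨ Bd n b (a + a')
  exists_small : ∀ p ∈ b, ∀ O, IsOpen O → p ∈ O → ∃ g, Coc n (O ∩ b) g ∧ ¬ Bd n b g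
  cover : ∀ K ⊆ b, IsCompact K → ∀ ε > 0, HasCover (n + 1) K ε

/-- All simplices on which `a` is nonzero meet `K`. -/
def Touches (K : Set X) (a : Coch X) : Prop := ∀ s, a s ≠ 0 → ∃ p ∈ s, p ∈ K

/-- A cochain on simplices with `k` vertices supported in `K`, with no smallness condition. -/
def Strict (k : ℕ) (K : Set X) (a : Coch X) : Prop :=
  ∀ s, a s ≠ 0 → s.Nonempty ∧ s.card = k ∧ (s : Set X) ⊆ K

lemma IsCochain.exists_strict {k : ℕ} {W : Set X} {a : Coch X} (h : IsCochain k W a) :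
    ∃ a₀ K, IsCompact K ∧ K ⊆ W ∧ Strict k K a₀ ∧ LZ (a + a₀) := by
  obtain ⟨K, h1, h2, h3⟩ := h
  refine ⟨fun s => if s.Nonempty ∧ s.card = k ∧ (s : Set X) ⊆ K then a s else 0, K, h1, h2,
    fun s hs => ?_, ?_⟩
  · by_contra hc
    exact hs (if_neg hc)
  · filter_upwards [h3] with s hs
    simp only [Pi.add_apply]
    split_ifs with h
    · exact ZModModule.add_self _
    · rw [add_zero]
      by_contra hc
      exact h (hs hc)

lemma Strict.isCochain {k : ℕ} {K W : Set X} {a : Coch X} (h : Strict k K a) (hK : IsCompact K)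
    (hW : K ⊆ W) : IsCochain k W a := ⟨K, hK, hW, Eventually.of_forall h⟩

lemma Strict.touches {k : ℕ} {K : Set X} {a : Coch X} (h : Strict k K a) : Touches K a :=
  fun s hs => by
    obtain ⟨⟨p, hp⟩, -, h3⟩ := h s hs
    exact ⟨p, hp, h3 hp⟩

lemma Touches.cob {K : Set X} {a : Coch X} (h : Touches K a) : Touches K (cob a) := fun s hs => by
  obtain ⟨v, hv, t, hts, -, -, ht⟩ := cob_ne_zero hs
  obtain ⟨p, hp, hpK⟩ := h t ht
  exact ⟨p, hts hp, hpK⟩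

lemma Touches.add {K K' : Set X} {a b : Coch X} (ha : Touches K a) (hb : Touches K' b) :
    Touches (K ∪ K') (a + b) := fun s hs => by
  by_cases h : a s = 0
  · obtain ⟨p, hp, hpK⟩ := hb s fun h' => hs (by simp [h, h'])
    exact ⟨p, hp, Or.inr hpK⟩
  · obtain ⟨p, hp, hpK⟩ := ha s h
    exact ⟨p, hp, Or.inl hpK⟩

lemma eventually_image_of_continuousOn [ProperSpace X] {f : X → M} {W L : Set X} (hW : IsOpen W)
    (hf : ContinuousOn f W) (hL : IsCompact L) (hLW : L ⊆ W) {P : Finset M → Prop}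
    (hP : ∀ᶠ t in smalls M, P t) :
    ∀ᶠ s : Finset X in smalls X, (∃ p ∈ s, p ∈ L) → (s : Set X) ⊆ W ∧ P (s.image f) := by
  obtain ⟨η, hη, hηW⟩ := hL.exists_cthickening_subset_open hW hLW
  have hu := hL.cthickening (r := η) |>.uniformContinuousOn_of_continuous (hf.mono hηW)
  obtain ⟨ε, hε, hP⟩ := eventually_smalls.1 hP
  obtain ⟨δ, hδ, hu⟩ := Metric.uniformContinuousOn_iff.1 hu ε hε
  filter_upwards [eventually_sm hη, eventually_sm hδ] with s h1 h2
  rintro ⟨p, hp, hpL⟩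
  have h3 := subset_cthickening_of_sm h1 hp hpL
  refine ⟨h3.trans hηW, hP _ fun x hx y hy => ?_⟩
  obtain ⟨x, hx', rfl⟩ := Finset.mem_image.1 hx
  obtain ⟨y, hy', rfl⟩ := Finset.mem_image.1 hy
  exact hu x (h3 hx') y (h3 hy') (h2 x hx' y hy')

variable [ProperSpace X] [ProperSpace M] {e : X → M}

lemma eventually_preimage (he : IsOpenEmbedding e) {L : Set M} (hL : IsCompact L)
    (hLe : L ⊆ Set.range e) {P : Finset X → Prop} (hP : ∀ᶠ s in smalls X, P s) :
    ∀ᶠ t in smalls M, (∃ p ∈ t, p ∈ L) → ∃ s : Finset X, s.image e = t ∧ P s := by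
  rcases isEmpty_or_nonempty X with hX | hX
  · refine Eventually.of_forall fun t ht => ?_
    obtain ⟨p, -, hp⟩ := ht
    obtain ⟨x, -⟩ := hLe hp
    exact hX.elim x
  let f := Function.invFun e
  have hf : ∀ y ∈ Set.range e, e (f y) = y := fun y hy => Function.invFun_eq hy
  have hfc : ContinuousOn f (Set.range e) := by
    rw [he.isOpen_range.continuousOn_iff]
    rintro _ ⟨x, rfl⟩
    have hx : f (e x) = x := Function.leftInverse_invFun he.injective x
    rw [ContinuousAt, hx, ← he.map_nhds_eq, tendsto_map'_iff]
    have : f ∘ e = id := funext fun x => Function.leftInverse_invFun he.injective x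
    rw [this]
    exact tendsto_id
  filter_upwards [eventually_image_of_continuousOn he.isOpen_range hfc hL hLe hP] with t ht hp
  obtain ⟨h1, h2⟩ := ht hp
  refine ⟨_, ?_, h2⟩
  rw [Finset.image_image]
  conv_rhs => rw [← Finset.image_id (s := t)]
  exact Finset.image_congr fun y hy => hf y (h1 hy)

lemma pull_of_injective (he : Function.Injective e) (a : Coch M) (s : Finset X) :
    pull e a s = a (s.image e) := if_pos he.injOn

lemma LZ_pull_iff (he : IsOpenEmbedding e) {K : Set M} (hK : IsCompact K)
    (hKe : K ⊆ Set.range e) {a : Coch M} (ha : Touches K a) : LZ (pull e a) ↔ LZ a := by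
  have hK' : IsCompact (e ⁻¹' K) := he.isInducing.isCompact_preimage' hK hKe
  constructor
  · intro h
    filter_upwards [eventually_preimage he hK hKe h] with t ht
    by_contra hne
    obtain ⟨s, rfl, hs⟩ := ht (ha t hne)
    rw [pull_of_injective he.injective] at hs
    exact hne hs
  · intro h
    filter_upwards [eventually_image_of_continuousOn isOpen_univ he.continuous.continuousOn hK'
      (Set.subset_univ _) h] with s hs
    by_contra hne
    rw [pull_of_injective he.injective] at hne
    obtain ⟨p, hp, hpK⟩ := ha _ hne
    obtain ⟨x, hx, rfl⟩ := Finset.mem_image.1 hp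
    exact hne (hs ⟨x, hx, hpK⟩).2

lemma Strict.pull {k : ℕ} {K : Set M} {a : Coch M} (h : Strict k K a)
    (he : Function.Injective e) : Strict k (e ⁻¹' K) (pull e a) := fun s hs => by
  rw [pull_of_injective he] at hs
  obtain ⟨h1, h2, h3⟩ := h _ hs
  refine ⟨by simpa using h1, by rwa [Finset.card_image_of_injective _ he] at h2, ?_⟩
  rwa [Finset.coe_image, Set.image_subset_iff] at h3

lemma Strict.exists_pull_eq {k : ℕ} {K : Set X} {c : Coch X} (h : Strict k K c)
    (he : Function.Injective e) : ∃ a, Strict k (e '' K) a ∧ SmallSimplices.pull e a = c := by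
  refine ⟨fun t => if h : ∃ s : Finset X, s.image e = t then c h.choose else 0, fun t ht => ?_, ?_⟩
  · simp only at ht
    split_ifs at ht with h'
    · obtain ⟨h1, h2, h3⟩ := h _ ht
      have h4 := h'.choose_spec
      rw [← h4]
      refine ⟨by simpa using h1, by rwa [Finset.card_image_of_injective _ he], ?_⟩
      rw [Finset.coe_image]
      exact Set.image_mono h3
    · exact absurd rfl ht
  · funext s
    rw [pull_of_injective he]
    have hex : ∃ s' : Finset X, s'.image e = s.image e := ⟨s, rfl⟩
    rw [dif_pos hex, Finset.image_injective he hex.choose_spec]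

lemma Bd.of_pull (he : IsOpenEmbedding e) {k j : ℕ} {K : Set M} (hK : IsCompact K)
    (hKe : K ⊆ Set.range e) {a : Coch M} (ha : Strict j K a) (h : Bd k Set.univ (pull e a)) :
    Bd k (Set.range e) a := by
  obtain ⟨c, h1, h2⟩ := h
  obtain ⟨c₀, L, hL, -, hs, hz⟩ := h1.exists_strict
  obtain ⟨b, hb, rfl⟩ := hs.exists_pull_eq he.injective
  have hLe : e '' L ⊆ Set.range e := Set.image_subset_range _ _
  refine ⟨b, hb.isCochain (hL.image he.continuous) hLe, ?_⟩
  rw [← LZ_pull_iff he (hK.union (hL.image he.continuous)) (Set.union_subset hKe hLe)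
    (ha.touches.add hb.touches.cob), pull_add, ← cob_pull]
  have h3 := hz.cob
  rw [cob_add] at h3
  convert h2.add h3 using 1
  funext s
  simp only [Pi.add_apply]
  grind

lemma Bd.pull (he : IsOpenEmbedding e) {k j : ℕ} {K : Set M} (hK : IsCompact K)
    (hKe : K ⊆ Set.range e) {a : Coch M} (ha : Strict j K a) (h : Bd k (Set.range e) a) :
    Bd k Set.univ (pull e a) := by
  obtain ⟨c, h1, h2⟩ := h
  obtain ⟨b, L, hL, hLe, hb, hz⟩ := h1.exists_strict
  refine ⟨SmallSimplices.pull e b, (hb.pull he.injective).isCochain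
    (he.isInducing.isCompact_preimage' hL hLe) (Set.subset_univ _), ?_⟩
  rw [cob_pull, ← pull_add, LZ_pull_iff he (hK.union hL) (Set.union_subset hKe hLe)
    (ha.touches.add hb.touches.cob)]
  have h3 := hz.cob
  rw [cob_add] at h3
  convert h2.add h3 using 1
  funext s
  simp only [Pi.add_apply]
  grind

lemma HasCover.image (he : IsOpenEmbedding e) {m : ℕ} {K : Set X} (hK : IsCompact K)
    (h : ∀ ε > 0, HasCover m K ε) {ε : ℝ} (hε : 0 < ε) : HasCover m (e '' K) ε := by
  have hu := hK.uniformContinuousOn_of_continuous he.continuous.continuousOn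
  obtain ⟨δ, hδ, hu⟩ := Metric.uniformContinuousOn_iff.1 hu ε hε
  obtain ⟨N, V, h1, h2, h3, h4⟩ := h δ hδ
  refine ⟨N, fun i => e '' (V i ∩ K), fun i => ((h1 i).inter hK).image he.continuous, ?_, ?_, ?_⟩
  · rintro _ ⟨x, hx, rfl⟩
    obtain ⟨i, hi⟩ := Set.mem_iUnion.1 (h2 hx)
    exact Set.mem_iUnion.2 ⟨i, x, ⟨hi, hx⟩, rfl⟩
  · rintro i _ ⟨x, hx, rfl⟩ _ ⟨y, hy, rfl⟩
    exact hu x hx.2 y hy.2 (h3 i x hx.1 y hy.1)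
  · intro p
    by_cases hp : ∃ x, e x = p
    · obtain ⟨x, rfl⟩ := hp
      refine (Finset.card_le_card fun i hi => ?_).trans (h4 x)
      simp only [Finset.mem_filter, Finset.mem_univ, true_and] at hi ⊢
      obtain ⟨y, hy, hxy⟩ := hi
      rw [← he.injective hxy]; exact hy.1
    · rw [Finset.filter_false_of_mem]
      · simp
      · rintro i - ⟨x, -, hx⟩
        exact hp ⟨x, hx⟩

/-- Goodness is a topological property. -/
lemma Good.range (he : IsOpenEmbedding e) {n : ℕ} (h : Good n (Set.univ : Set X)) :
    Good n (Set.range e) := by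
  refine ⟨he.isOpen_range, fun a a' ha ha' => ?_, ?_, fun K hKe hK ε hε => ?_⟩
  · obtain ⟨a₀, K, hK, hKe, hs, hz⟩ := ha.1.exists_strict
    obtain ⟨a₀', K', hK', hKe', hs', hz'⟩ := ha'.1.exists_strict
    have hc : ∀ {a : Coch M} {K}, IsCompact K → K ⊆ Set.range e → Strict (n + 1) K a →
        Coc n (Set.range e) a → Coc n Set.univ (SmallSimplices.pull e a) := by
      intro a K hK hKe hs ha
      refine ⟨(hs.pull he.injective).isCochain (he.isInducing.isCompact_preimage' hK hKe)
        (Set.subset_univ _), ?_⟩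
      rw [cob_pull, LZ_pull_iff he hK hKe hs.touches.cob]
      exact ha.2
    have hz0 : LZ (a₀ + a) := by rwa [add_comm]
    have hz0' : LZ (a₀' + a') := by rwa [add_comm]
    rcases h.unique _ _ (hc hK hKe hs (ha.congr hz)) (hc hK' hKe' hs' (ha'.congr hz'))
      with h1 | h1 | h1
    · exact Or.inl ((h1.of_pull he hK hKe hs).congr hz0)
    · exact Or.inr (Or.inl ((h1.of_pull he hK' hKe' hs').congr hz0'))
    · refine Or.inr (Or.inr ?_)
      rw [← pull_add] at h1
      have hs2 : Strict (n + 1) (K ∪ K') (a₀ + a₀') := fun s hne => by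
        by_cases h0 : a₀ s = 0
        · obtain ⟨h3, h4, h5⟩ := hs' s fun h' => hne (by simp [h0, h'])
          exact ⟨h3, h4, h5.trans Set.subset_union_right⟩
        · obtain ⟨h3, h4, h5⟩ := hs s h0
          exact ⟨h3, h4, h5.trans Set.subset_union_left⟩
      refine (h1.of_pull he (hK.union hK') (Set.union_subset hKe hKe') hs2).congr ?_
      convert hz.add hz' using 1
      abel
  · rintro _ ⟨x, rfl⟩ O hO hp
    obtain ⟨g, hg, hgn⟩ := h.exists_small x trivial _ (hO.preimage he.continuous) hp
    obtain ⟨g₀, K, hK, hKO, hs, hz⟩ := hg.1.exists_strict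
    obtain ⟨a, ha, rfl⟩ := hs.exists_pull_eq he.injective
    have hKe : e '' K ⊆ Set.range e := Set.image_subset_range _ _
    refine ⟨a, ⟨ha.isCochain (hK.image he.continuous) ?_, ?_⟩, fun hb => hgn ?_⟩
    · rintro _ ⟨y, hy, rfl⟩
      exact ⟨(hKO hy).1, y, rfl⟩
    · rw [← LZ_pull_iff he (hK.image he.continuous) hKe ha.touches.cob, ← cob_pull]
      exact (hg.congr hz).2
    · refine (hb.pull he (hK.image he.continuous) hKe ha).congr ?_
      rwa [add_comm]
  · rw [← Set.image_preimage_eq_of_subset hKe]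
    have hK' : IsCompact (e ⁻¹' K) := he.isInducing.isCompact_preimage' hK hKe
    exact HasCover.image he hK' (h.cover _ (Set.subset_univ _) hK') hε

end Transport

end SmallSimplices

/-! ### Euclidean space -/

namespace SmallSimplices

open Filter Topology

section Prism

variable {X Y : Type*} [MetricSpace X] [MetricSpace Y]

lemma eventually_image {f : X → Y} (hf : UniformContinuous f) {P : Finset Y → Prop}
    (hP : ∀ᶠ t in smalls Y, P t) :
    ∀ᶠ s : Finset X in smalls X, ∀ t : Finset Y, (t : Set Y) ⊆ f '' s → P t := by
  obtain ⟨ε, hε, hP⟩ := eventually_smalls.1 hP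
  obtain ⟨δ, hδ, hu⟩ := Metric.uniformContinuous_iff.1 hf ε hε
  filter_upwards [eventually_sm hδ] with s hs t ht
  refine hP t fun p hp q hq => ?_
  obtain ⟨x, hx, rfl⟩ := ht hp
  obtain ⟨y, hy, rfl⟩ := ht hq
  exact hu (hs x hx y hy)

lemma pull_congr {f : X → Y} {a b : Coch Y} {s : Finset X}
    (h : ∀ t : Finset Y, (t : Set Y) = f '' s → a t = b t) : pull f a s = pull f b s := by
  unfold pull
  split_ifs with hi
  · exact h _ (by simp)
  · rfl

lemma LZ.pull {f : X → Y} (hf : UniformContinuous f) {a : Coch Y} (h : LZ a) :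
    LZ (pull f a) := by
  filter_upwards [eventually_image hf h] with s hs
  by_contra hne
  obtain ⟨t, ht, -, h'⟩ := pull_ne_zero hne
  exact h' (hs t ht.subset)

/-- A cochain closed on small simplices in `A` has cohomologous pullbacks along maps to `A`
connected by sufficiently many intermediate steps. -/
lemma exists_prism {a : Coch Y} {A : Set Y} {P : Finset Y → Prop}
    (ha : ∀ᶠ t : Finset Y in smalls Y, (t : Set Y) ⊆ A → cob a t = 0)
    (hP : ∀ᶠ t in smalls Y, P t) :
    ∃ η > 0, ∀ F : ℕ → X → Y, (∀ j, UniformContinuous (F j)) → (∀ j x, F j x ∈ A) →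
      (∀ j x, dist (F j x) (F (j + 1) x) < η) → ∀ N, ∃ q : Coch X,
        LZ (pull (F 0) a + pull (F N) a + cob q) ∧ ∀ᶠ s : Finset X in smalls X, q s ≠ 0 →
          ∃ j < N, ∃ t : Finset Y, (t : Set Y) ⊆ F j '' s ∪ F (j + 1) '' s ∧
            t.card = s.card + 1 ∧ a t ≠ 0 ∧ P t := by
  obtain ⟨ε, hε, h0⟩ := eventually_smalls.1 (ha.and hP)
  refine ⟨ε / 3, by positivity, fun F hF hA hd N => ?_⟩
  have hsm : ∀ j, ∀ᶠ s : Finset X in smalls X, ∀ t : Finset Y,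
      (t : Set Y) ⊆ F j '' s ∪ F (j + 1) '' s → Sm ε t := by
    intro j
    obtain ⟨δ, hδ, hu⟩ := Metric.uniformContinuous_iff.1 (hF j) (ε / 3) (by positivity)
    obtain ⟨δ', hδ', hu'⟩ := Metric.uniformContinuous_iff.1 (hF (j + 1)) (ε / 3) (by positivity)
    filter_upwards [eventually_sm hδ, eventually_sm hδ'] with s hs hs' t ht
    intro p hp q hq
    have h1 : ∀ p ∈ t, ∃ x ∈ s, p = F j x ∨ p = F (j + 1) x := fun p hp => by
      rcases ht hp with ⟨x, hx, rfl⟩ | ⟨x, hx, rfl⟩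
      exacts [⟨x, hx, .inl rfl⟩, ⟨x, hx, .inr rfl⟩]
    obtain ⟨x, hx, hpx⟩ := h1 p hp
    obtain ⟨y, hy, hqy⟩ := h1 q hq
    have h2 := hu (hs x hx y hy)
    have h3 := hu' (hs' x hx y hy)
    have h4 := hd j x
    have h5 := hd j y
    rw [dist_comm] at h4
    rcases hpx with rfl | rfl <;> rcases hqy with rfl | rfl
    · linarith
    · linarith [dist_triangle (F j x) (F j y) (F (j + 1) y)]
    · linarith [dist_triangle (F (j + 1) x) (F j x) (F j y)]
    · linarith
  induction N with
  | zero =>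
    refine ⟨0, ?_, Eventually.of_forall fun s hs => absurd rfl hs⟩
    refine Eventually.of_forall fun s => ?_
    simp [cob, ZModModule.add_self]
  | succ N ih =>
    obtain ⟨q, hq, hq'⟩ := ih
    obtain ⟨T, hT, hTs⟩ := exists_homotopy (F N) (F (N + 1))
    refine ⟨q + T a, ?_, ?_⟩
    · filter_upwards [hq, hsm N] with s h1 h2
      have h3 := congrFun (hT a) s
      have h4 : T (cob a) s = 0 := by
        by_contra hne
        obtain ⟨t, ht, -, hn⟩ := hTs _ s hne
        refine hn ((h0 t (h2 t ht)).1 fun p hp => ?_)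
        rcases ht hp with ⟨x, hx, rfl⟩ | ⟨x, hx, rfl⟩ <;> exact hA _ _
      rw [cob_add]
      simp only [Pi.add_apply] at *
      grind
    · filter_upwards [hq', hsm N] with s h1 h2 h3
      by_cases h : q s = 0
      · have h4 : T a s ≠ 0 := by simpa [h] using h3
        obtain ⟨t, ht, hc, hn⟩ := hTs _ s h4
        exact ⟨N, Nat.lt_succ_self _, t, ht, hc, hn, (h0 t (h2 t ht)).2⟩
      · obtain ⟨j, hj, h5⟩ := h1 h
        exact ⟨j, hj.trans (Nat.lt_succ_self _), h5⟩

end Prism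

end SmallSimplices

namespace SmallSimplices

open Filter Topology

section Product

open scoped Classical

variable {Y : Type*} [MetricSpace Y] [ProperSpace Y]

lemma exists_box {K : Set (Y × ℝ)} (hK : IsCompact K) :
    ∃ (L : Set Y) (R : ℝ), IsCompact L ∧ 0 < R ∧ ∀ p ∈ K, p.1 ∈ L ∧ |p.2| ≤ R := by
  obtain ⟨R, hR⟩ := (hK.image continuous_snd).isBounded.exists_norm_le
  refine ⟨Prod.fst '' K, max R 1, hK.image continuous_fst, by positivity, fun p hp => ?_⟩
  exact ⟨⟨p, hp, rfl⟩, (hR p.2 ⟨p, hp, rfl⟩).trans (le_max_left _ _)⟩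

/-- The small simplices in the support of `q` have `k` vertices in a half-infinite tube. -/
def IsTube (k : ℕ) (L : Set Y) (R : ℝ) (q : Coch (Y × ℝ)) : Prop :=
  ∀ᶠ s : Finset (Y × ℝ) in smalls (Y × ℝ), q s ≠ 0 →
    s.Nonempty ∧ s.card = k ∧ ∀ p ∈ s, p.1 ∈ L ∧ p.2 ≤ R

lemma exists_tube {k : ℕ} {a : Coch (Y × ℝ)} (ha : Coc k Set.univ a) :
    ∃ q L R, IsCompact L ∧ IsTube k L R q ∧ LZ (a + cob q) ∧
      ∀ᶠ s : Finset (Y × ℝ) in smalls (Y × ℝ), a s ≠ 0 → ∀ p ∈ s, -R ≤ p.2 := by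
  obtain ⟨⟨K, hK, -, hs⟩, hz⟩ := ha
  obtain ⟨L, R, hL, hR, hKR⟩ := exists_box hK
  obtain ⟨η, hη, hF⟩ := exists_prism (X := Y × ℝ) (A := Set.univ) (hz.mono fun _ h _ => h) hs
  obtain ⟨N, hN⟩ := exists_nat_gt ((2 * R + 1) / (η / 2))
  let F : ℕ → Y × ℝ → Y × ℝ := fun j p => (p.1, max p.2 (-R - 1 + j * (η / 2)))
  have hFu : ∀ j, UniformContinuous (F j) := fun j => by
    refine uniformContinuous_fst.prodMk ?_
    exact (LipschitzWith.prod_snd.max_const _).uniformContinuous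
  have hFd : ∀ j x, dist (F j x) (F (j + 1) x) < η := fun j x => by
    rw [Prod.dist_eq, dist_self, max_eq_right dist_nonneg, Real.dist_eq]
    simp only [F]
    rw [max_comm, max_comm x.2]
    refine (abs_max_sub_max_le_abs _ _ _).trans_lt ?_
    rw [abs_lt]
    push_cast
    constructor <;> linarith
  obtain ⟨q, hq, hq'⟩ := hF F hFu (fun _ _ => trivial) hFd N
  refine ⟨q, cthickening 1 L, R + 1, hL.cthickening, ?_, ?_, ?_⟩
  · filter_upwards [hq', eventually_sm one_pos] with s h1 h2 h3
    obtain ⟨j, -, t, ht, hc, hn, h4⟩ := h1 h3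
    obtain ⟨⟨p, hp⟩, h5, h6⟩ := h4 hn
    obtain ⟨x, hx, h7, h8⟩ : ∃ x ∈ s, x.1 ∈ L ∧ x.2 ≤ R := by
      have h9 := hKR p (h6 hp)
      rcases ht hp with ⟨x, hx, rfl⟩ | ⟨x, hx, rfl⟩ <;>
      exact ⟨x, hx, h9.1, (le_max_left _ _).trans (le_abs_self _) |>.trans h9.2⟩
    refine ⟨⟨x, hx⟩, by omega, fun y hy => ?_⟩
    have h10 := h2 y hy x hx
    rw [Prod.dist_eq, max_lt_iff, Real.dist_eq, abs_lt] at h10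
    exact ⟨mem_cthickening_of_dist_le _ _ _ _ h7 h10.1.le, by linarith [h10.2.2]⟩
  · have h0 : LZ (a + pull (F 0) a) := by
      filter_upwards [eventually_image (hFu 0) hs, hs, eventually_sm one_pos] with s h1 h2 h3
      simp only [Pi.add_apply]
      by_cases hp : ∀ p ∈ s, -R - 1 ≤ p.2
      · have : pull (F 0) a s = a s := by
          rw [pull_eq_of_eqOn (g := id), pull_id]
          intro p hp'
          simp only [F, id]
          ext
          · rfl
          · simp [hp p hp']
        rw [this, ZModModule.add_self]
      · push Not at hp
        obtain ⟨p, hp, hpR⟩ := hp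
        have h4 : a s = 0 := by
          by_contra hne
          linarith [(abs_le.1 (hKR p ((h2 hne).2.2 hp)).2).1]
        have h5 : pull (F 0) a s = 0 := by
          by_contra hne
          obtain ⟨t, ht, -, hn⟩ := pull_ne_zero hne
          have h6 : F 0 p ∈ K := (h1 t ht.subset hn).2.2 (ht.symm ▸ ⟨p, hp, rfl⟩)
          have h7 := (hKR _ h6).2
          simp only [F, Nat.cast_zero, zero_mul, add_zero] at h7
          rw [max_eq_right hpR.le] at h7
          linarith [(abs_le.1 h7).1]
        rw [h4, h5, add_zero]
    have hN' : LZ (pull (F N) a) := by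
      filter_upwards [eventually_image (hFu N) hs] with s h1
      by_contra hne
      obtain ⟨t, ht, -, hn⟩ := pull_ne_zero hne
      obtain ⟨⟨p, hp⟩, -, h2⟩ := h1 t ht.subset hn
      obtain ⟨x, hx, rfl⟩ := ht.subset hp
      have h7 := (hKR _ (h2 hp)).2
      rw [div_lt_iff₀ (by positivity)] at hN
      have := (le_max_right _ _).trans ((le_abs_self _).trans h7)
      linarith
    convert (h0.add hN').add hq using 1
    funext s
    simp only [Pi.add_apply]
    grind
  · filter_upwards [hs] with s h1 h2 p hp
    linarith [(abs_le.1 (hKR p ((h1 h2).2.2 hp)).2).1]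

lemma uniformContinuous_slice (u : ℝ) : UniformContinuous (fun y : Y => (y, u)) :=
  uniformContinuous_id.prodMk uniformContinuous_const

/-- The part of a cocycle far from a slice bounds if its restriction to that slice does. -/
lemma bd_of_slice {k : ℕ} {a q : Coch (Y × ℝ)} {L : Set Y} {R u₀ : ℝ} (hL : IsCompact L)
    (hq : IsTube (k + 1) L R q) (haq : LZ (a + cob q))
    (hau : ∀ᶠ s : Finset (Y × ℝ) in smalls (Y × ℝ), a s ≠ 0 → ∀ p ∈ s, u₀ + 1 < p.2)
    (hb : Bd k Set.univ (pull (fun y => (y, u₀)) q)) : Bd (k + 1) Set.univ a := by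
  obtain ⟨f, hf, hqf⟩ := hb
  obtain ⟨Kf, hKf, -, hfs⟩ := hf
  have hcl : ∀ᶠ t : Finset (Y × ℝ) in smalls (Y × ℝ), (t : Set (Y × ℝ)) ⊆ {p | p.2 ≤ u₀ + 1} →
      cob q t = 0 := by
    filter_upwards [haq, hau] with t h1 h2 h3
    have h4 : a t = 0 ∨ t = ∅ := by
      by_contra hc
      push Not at hc
      obtain ⟨p, hp⟩ := hc.2
      exact (h2 hc.1 p hp).not_ge (h3 hp)
    rcases h4 with h4 | rfl
    · simpa [h4] using h1
    · simp [cob]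
  obtain ⟨η, hη, hF⟩ := exists_prism (X := Y × ℝ) hcl hq
  obtain ⟨N, hN⟩ := exists_nat_gt (1 / η)
  have hN0 : (0 : ℝ) < N := lt_trans (by positivity) hN
  let F : ℕ → Y × ℝ → Y × ℝ := fun j p => (p.1, min (max p.2 u₀) (u₀ + 1 - j / N))
  have hFu : ∀ j, UniformContinuous (F j) := fun j => by
    refine uniformContinuous_fst.prodMk ?_
    exact ((LipschitzWith.prod_snd.max_const _).min_const _).uniformContinuous
  have hFd : ∀ j x, dist (F j x) (F (j + 1) x) < η := fun j x => by
    rw [Prod.dist_eq, dist_self, max_eq_right dist_nonneg, Real.dist_eq]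
    have h1 : |(u₀ + 1 - (j : ℝ) / N) - (u₀ + 1 - ((j + 1 : ℕ) : ℝ) / N)| < η := by
      rw [show (u₀ + 1 - (j : ℝ) / N) - (u₀ + 1 - ((j + 1 : ℕ) : ℝ) / N) = 1 / N by
        push_cast; field_simp; ring, abs_of_pos (by positivity), div_lt_iff₀ hN0]
      rwa [div_lt_iff₀ hη, mul_comm] at hN
    refine (abs_min_sub_min_le_max _ _ _ _).trans_lt (max_lt (by simpa using hη) h1)
  obtain ⟨qt, hqt, hqt'⟩ := hF F hFu (fun j x => by
    have : (0 : ℝ) ≤ j / N := by positivity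
    exact (min_le_right _ _).trans (sub_le_self _ this)) hFd N
  let w : Coch (Y × ℝ) := qt + pull Prod.fst f
  have hw : ∃ L', IsCompact L' ∧ ∀ᶠ s : Finset (Y × ℝ) in smalls (Y × ℝ), w s ≠ 0 →
      s.Nonempty ∧ s.card = k ∧ ∀ p ∈ s, p.1 ∈ L' := by
    refine ⟨cthickening 1 L ∪ Kf, hL.cthickening.union hKf, ?_⟩
    filter_upwards [hqt', eventually_image uniformContinuous_fst hfs, eventually_sm one_pos]
      with s h1 h2 h3 h4
    by_cases h : qt s = 0
    · have h5 : pull Prod.fst f s ≠ 0 := by simpa [w, h] using h4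
      obtain ⟨t, ht, hc, hn⟩ := pull_ne_zero h5
      obtain ⟨h6, h7, h8⟩ := h2 t ht.subset hn
      refine ⟨?_, by omega, fun p hp => .inr (h8 (ht.symm ▸ ⟨p, hp, rfl⟩))⟩
      rw [← Finset.card_pos] at h6 ⊢
      omega
    · obtain ⟨j, -, t, ht, hc, hn, h5⟩ := h1 h
      obtain ⟨⟨p, hp⟩, h6, h7⟩ := h5 hn
      obtain ⟨x, hx, h8⟩ : ∃ x ∈ s, x.1 ∈ L := by
        have h9 := (h7 p hp).1
        rcases ht hp with ⟨x, hx, rfl⟩ | ⟨x, hx, rfl⟩ <;> exact ⟨x, hx, h9⟩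
      refine ⟨⟨x, hx⟩, by omega, fun y hy => .inl ?_⟩
      have h10 := h3 y hy x hx
      rw [Prod.dist_eq, max_lt_iff] at h10
      exact mem_cthickening_of_dist_le _ _ _ _ h8 h10.1.le
  obtain ⟨L', hL', hws⟩ := hw
  have hqw : ∀ᶠ s : Finset (Y × ℝ) in smalls (Y × ℝ), (∀ p ∈ s, u₀ ≤ p.2 ∧ p.2 ≤ u₀ + 1) →
      q s = cob w s := by
    have hpp := hqf.pull (f := (Prod.fst : Y × ℝ → Y)) uniformContinuous_fst
    rw [pull_add, pull_comp, ← cob_pull] at hpp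
    filter_upwards [hqt, hpp] with s h1 h2 h3
    have h4 : pull (F 0) q s = q s := by
      rw [pull_eq_of_eqOn (g := id), pull_id]
      intro p hp
      have := h3 p hp
      ext
      · rfl
      · simp [F, this]
    have h5 : F N = (fun y => (y, u₀)) ∘ Prod.fst := by
      funext p
      simp [F, hN0.ne']
    rw [cob_add]
    simp only [Pi.add_apply, h4, h5] at *
    grind
  let w' : Coch (Y × ℝ) := fun s => if ∀ p ∈ s, p.2 ≤ u₀ + 1 / 2 then w s else 0
  let b : Coch (Y × ℝ) := fun s => if ∀ p ∈ s, u₀ ≤ p.2 then (q + cob w') s else 0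
  refine ⟨b, ⟨cthickening 1 (L ∪ L') ×ˢ Set.Icc u₀ (max R (u₀ + 1)),
    (hL.union hL').cthickening.prod isCompact_Icc, Set.subset_univ _, ?_⟩, ?_⟩
  · filter_upwards [hq, eventually_subset hws, eventually_sm (show (0 : ℝ) < 1 / 2 by norm_num)]
      with s h1 h2 h3 h4
    have h5 : ∀ p ∈ s, u₀ ≤ p.2 := by
      by_contra hc
      exact h4 (if_neg hc)
    simp only [b, if_pos h5, Pi.add_apply] at h4
    by_cases h : q s = 0
    · have h6 : cob w' s ≠ 0 := by simpa [h] using h4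
      obtain ⟨v, hv, t, hts, hc, -, hn⟩ := cob_ne_zero h6
      have h7 : ∀ p ∈ t, p.2 ≤ u₀ + 1 / 2 := by
        by_contra hc
        exact hn (if_neg hc)
      simp only [w', if_pos h7] at hn
      obtain ⟨⟨x, hx⟩, h8, h9⟩ := h2 t hts hn
      refine ⟨⟨v, hv⟩, by omega, fun y hy => ?_⟩
      have h10 := h3 y hy x (hts hx)
      rw [Prod.dist_eq, max_lt_iff, Real.dist_eq, abs_lt] at h10
      refine ⟨mem_cthickening_of_dist_le _ _ _ _ (.inr (h9 x hx)) (h10.1.le.trans (by norm_num)),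
        h5 y hy, le_max_of_le_right ?_⟩
      linarith [h7 x hx, h10.2.2]
    · obtain ⟨h6, h7, h8⟩ := h1 h
      exact ⟨h6, h7, fun y hy => ⟨self_subset_cthickening _ (.inl (h8 y hy).1), h5 y hy,
        le_max_of_le_left (h8 y hy).2⟩⟩
  · filter_upwards [haq, hau, eventually_subset hqw,
      eventually_sm (show (0 : ℝ) < 1 / 2 by norm_num)] with s h1 h2 h3 h4
    simp only [Pi.add_apply] at h1 ⊢
    by_cases h : ∀ p ∈ s, u₀ ≤ p.2
    · have h5 : cob b s = cob (q + cob w') s :=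
        cob_congr fun t ht _ => if_pos fun p hp => h p (ht hp)
      rw [h5, cob_add, cob_cob, add_zero, h1]
    · push Not at h
      obtain ⟨p, hp, hpu⟩ := h
      have h5 : a s = 0 := by
        by_contra hn
        linarith [h2 hn p hp]
      have h6 : ∀ x ∈ s, x.2 ≤ u₀ + 1 / 2 := fun x hx => by
        have h10 := h4 x hx p hp
        rw [Prod.dist_eq, max_lt_iff, Real.dist_eq, abs_lt] at h10
        linarith [h10.2.2]
      rw [h5, zero_add]
      suffices hb : ∀ t ⊆ s, b t = 0 from
        Finset.sum_eq_zero fun v _ => hb _ (@Finset.erase_subset _ (_) _ _)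
      intro t hsub
      by_cases h7 : ∀ p ∈ t, u₀ ≤ p.2
      · have h8 : cob w' t = cob w t :=
          cob_congr fun t' ht _ => if_pos fun p hp => h6 p (hsub (ht hp))
        simp only [b, if_pos h7, Pi.add_apply]
        rw [h8, ← h3 _ hsub fun p hp => ⟨h7 p hp, (h6 p (hsub hp)).trans (by linarith)⟩,
          ZModModule.add_self]
      · exact if_neg h7

end Product

end SmallSimplices

namespace SmallSimplices

open Filter Topology

section Euclidean

open scoped Classical

variable {Y : Type*} [MetricSpace Y] [ProperSpace Y]

lemma IsTube.mono {k : ℕ} {L L' : Set Y} {R R' : ℝ} {q : Coch (Y × ℝ)} (h : IsTube k L R q)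
    (hL : L ⊆ L') (hR : R ≤ R') : IsTube k L' R' q := by
  filter_upwards [h] with s h1 h2
  obtain ⟨h3, h4, h5⟩ := h1 h2
  exact ⟨h3, h4, fun p hp => ⟨hL (h5 p hp).1, (h5 p hp).2.trans hR⟩⟩

lemma IsTube.add {k : ℕ} {L : Set Y} {R : ℝ} {q q' : Coch (Y × ℝ)} (h : IsTube k L R q)
    (h' : IsTube k L R q') : IsTube k L R (q + q') := by
  filter_upwards [h, h'] with s h1 h2 h3
  by_cases hq : q s = 0
  · exact h2 fun h => h3 (by simp [hq, h])
  · exact h1 hq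

lemma coc_slice {k : ℕ} {a q : Coch (Y × ℝ)} {L : Set Y} {R u₀ : ℝ} (hL : IsCompact L)
    (hq : IsTube (k + 1) L R q) (haq : LZ (a + cob q))
    (hau : ∀ᶠ s : Finset (Y × ℝ) in smalls (Y × ℝ), a s ≠ 0 → s.Nonempty ∧ ∀ p ∈ s, u₀ + 1 < p.2) :
    Coc k Set.univ (pull (fun y => (y, u₀)) q) := by
  refine ⟨⟨L, hL, Set.subset_univ _, ?_⟩, ?_⟩
  · filter_upwards [eventually_image (uniformContinuous_slice u₀) hq] with s h1 h2
    obtain ⟨t, ht, hc, hn⟩ := pull_ne_zero h2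
    obtain ⟨h3, h4, h5⟩ := h1 t ht.subset hn
    refine ⟨?_, by omega, fun y hy => ?_⟩
    · rw [← Finset.card_pos] at h3 ⊢
      omega
    · exact (h5 (y, u₀) (ht.symm ▸ ⟨y, hy, rfl⟩ : (y, u₀) ∈ (t : Set (Y × ℝ)))).1
  · have h := haq.pull (uniformContinuous_slice (Y := Y) u₀)
    rw [pull_add, ← cob_pull] at h
    refine LZ.congr ?_ h
    filter_upwards [eventually_image (uniformContinuous_slice u₀) hau] with s h1
    by_contra hne
    obtain ⟨t, ht, hc, hn⟩ := pull_ne_zero hne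
    obtain ⟨⟨p, hp⟩, h2⟩ := h1 t ht.subset hn
    obtain ⟨y, -, rfl⟩ := ht.subset hp
    linarith [h2 _ hp]

lemma unique_prod {n : ℕ} (hY : Good n (Set.univ : Set Y)) {a a' : Coch (Y × ℝ)}
    (ha : Coc (n + 1) Set.univ a) (ha' : Coc (n + 1) Set.univ a') :
    Bd (n + 1) Set.univ a ∨ Bd (n + 1) Set.univ a' ∨ Bd (n + 1) Set.univ (a + a') := by
  obtain ⟨q, L, R, hL, hq, haq, hR⟩ := exists_tube ha
  obtain ⟨q', L', R', hL', hq', haq', hR'⟩ := exists_tube ha'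
  let u₀ := - max R R' - 2
  replace hq := hq.mono (Set.subset_union_left (t := L')) (le_max_left R R')
  replace hq' := hq'.mono (Set.subset_union_right (s := L)) (le_max_right R R')
  have hau : ∀ᶠ s : Finset (Y × ℝ) in smalls (Y × ℝ), a s ≠ 0 → ∀ p ∈ s, u₀ + 1 < p.2 :=
    hR.mono fun s h1 h2 p hp => by
      simp only [u₀]; linarith [h1 h2 p hp, le_max_left R R']
  have hau' : ∀ᶠ s : Finset (Y × ℝ) in smalls (Y × ℝ), a' s ≠ 0 → ∀ p ∈ s, u₀ + 1 < p.2 :=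
    hR'.mono fun s h1 h2 p hp => by
      simp only [u₀]; linarith [h1 h2 p hp, le_max_right R R']
  have hne : ∀ {b : Coch (Y × ℝ)}, Coc (n + 1) Set.univ b →
      (∀ᶠ s : Finset (Y × ℝ) in smalls (Y × ℝ), b s ≠ 0 → ∀ p ∈ s, u₀ + 1 < p.2) →
      ∀ᶠ s : Finset (Y × ℝ) in smalls (Y × ℝ), b s ≠ 0 →
        s.Nonempty ∧ ∀ p ∈ s, u₀ + 1 < p.2 := by
    intro b hb h
    obtain ⟨⟨K, -, -, hs⟩, -⟩ := hb
    filter_upwards [h, hs] with s h1 h2 h3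
    exact ⟨(h2 h3).1, h1 h3⟩
  have hLL := hL.union hL'
  rcases hY.unique _ _ (coc_slice hLL hq haq (hne ha hau)) (coc_slice hLL hq' haq' (hne ha' hau'))
    with h | h | h
  · exact .inl (bd_of_slice hLL hq haq hau h)
  · exact .inr (.inl (bd_of_slice hLL hq' haq' hau' h))
  · rw [← pull_add] at h
    refine .inr (.inr (bd_of_slice hLL (hq.add hq') ?_ ?_ h))
    · rw [cob_add]
      convert haq.add haq' using 1
      abel
    · filter_upwards [hau, hau'] with s h1 h2 h3
      by_cases h4 : a s = 0
      · exact h2 fun h => h3 (by simp [h4, h])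
      · exact h1 h4

lemma exists_small_prod {n : ℕ} (hY : Good n (Set.univ : Set Y)) (p : Y × ℝ) {O : Set (Y × ℝ)}
    (hO : IsOpen O) (hp : p ∈ O) :
    ∃ g, Coc (n + 1) O g ∧ ¬ Bd (n + 1) Set.univ g := by
  obtain ⟨ρ, hρ, hρO⟩ := Metric.isOpen_iff.1 hO p hp
  obtain ⟨g, hg, hgn⟩ := hY.exists_small p.1 trivial (ball p.1 ρ) isOpen_ball (mem_ball_self hρ)
  obtain ⟨⟨Kg, hKg, hKgρ, hgs⟩, hgz⟩ := hg
  let h : Coch (Y × ℝ) := fun s => if ∀ x ∈ s, x.2 ≤ p.2 then pull Prod.fst g s else 0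
  have hpos : ∀ t, (∀ x ∈ t, x.2 ≤ p.2) → h t = pull Prod.fst g t := fun t ht => if_pos ht
  have hh : ∀ᶠ s : Finset (Y × ℝ) in smalls (Y × ℝ), h s ≠ 0 →
      s.Nonempty ∧ s.card = n + 1 ∧ ∀ x ∈ s, x.1 ∈ Kg ∧ x.2 ≤ p.2 := by
    filter_upwards [eventually_image uniformContinuous_fst hgs] with s h1 h2
    have h3 : ∀ x ∈ s, x.2 ≤ p.2 := by
      by_contra hc
      exact h2 (if_neg hc)
    simp only [h, if_pos h3] at h2
    obtain ⟨t, ht, hc, hn⟩ := pull_ne_zero h2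
    obtain ⟨h6, h7, h8⟩ := h1 t ht.subset hn
    refine ⟨?_, by omega, fun x hx => ⟨h8 (ht.symm ▸ ⟨x, hx, rfl⟩), h3 x hx⟩⟩
    rw [← Finset.card_pos] at h6 ⊢
    omega
  refine ⟨cob h, ⟨?_, by rw [cob_cob]; exact .zero⟩, ?_⟩
  · refine .of_near (hKg.prod (isCompact_singleton (x := p.2))) ?_ hO fun η hη => ?_
    · rintro ⟨y, u⟩ ⟨h1, rfl⟩
      exact hρO (by simpa [Prod.dist_eq, hρ] using hKgρ h1)
    have hgz' := hgz.pull (f := (Prod.fst : Y × ℝ → Y)) uniformContinuous_fst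
    rw [← cob_pull] at hgz'
    filter_upwards [eventually_subset hh, eventually_sm hη, hgz'] with s h1 h2 h3 h4
    have h5 : ∃ x ∈ s, p.2 < x.2 := by
      by_contra! hc
      refine h4 ?_
      rw [← h3]
      exact cob_congr fun t ht _ => if_pos fun x hx => hc x (ht hx)
    obtain ⟨x, hx, hxp⟩ := h5
    obtain ⟨v, hv, t, hts, hc, -, hn⟩ := cob_ne_zero h4
    obtain ⟨⟨z, hz⟩, h6, h7⟩ := h1 t hts hn
    refine ⟨⟨v, hv⟩, by omega, fun w hw => ?_⟩
    refine mem_cthickening_of_dist_le w (z.1, p.2) _ _ ⟨(h7 z hz).1, rfl⟩ ?_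
    have h8 := h2 w hw z (hts hz)
    have h9 := h2 w hw x hx
    rw [Prod.dist_eq, max_lt_iff, Real.dist_eq, abs_lt] at h8 h9
    rw [Prod.dist_eq, max_le_iff, Real.dist_eq, abs_le]
    refine ⟨h8.1.le, ?_, ?_⟩ <;> simp only <;> linarith [h8.2.1, h8.2.2, h9.2.1, h9.2.2, (h7 z hz).2]
  · rintro ⟨b, ⟨K, hK, -, hbs⟩, hz⟩
    obtain ⟨L, R, hL, hR, hKR⟩ := exists_box hK
    rw [← cob_add] at hz
    have hc : ∀ᶠ s : Finset (Y × ℝ) in smalls (Y × ℝ), (h + b) s ≠ 0 →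
        s.Nonempty ∧ s.card = n + 1 ∧ ∀ x ∈ s, x.1 ∈ Kg ∪ L := by
      filter_upwards [hh, hbs] with s h1 h2 h3
      by_cases h4 : h s = 0
      · obtain ⟨h5, h6, h7⟩ := h2 fun h => h3 (by simp [h4, h])
        exact ⟨h5, h6, fun x hx => .inr (hKR x (h7 hx)).1⟩
      · obtain ⟨h5, h6, h7⟩ := h1 h4
        exact ⟨h5, h6, fun x hx => .inl (h7 x hx).1⟩
    obtain ⟨η, hη, hF⟩ := exists_prism (X := Y) (A := Set.univ) (hz.mono fun _ h _ => h) hc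
    let u₁ := - |p.2| - R - 1
    obtain ⟨N, hN⟩ := exists_nat_gt ((2 * |p.2| + 2 * R + 1) / (η / 2))
    rw [div_lt_iff₀ (by positivity)] at hN
    obtain ⟨q, hq, hqs⟩ := hF (fun j y => (y, u₁ + j * (η / 2)))
      (fun j => uniformContinuous_slice _) (fun _ _ => trivial) (fun j y => by
        rw [Prod.dist_eq, dist_self, max_eq_right dist_nonneg, Real.dist_eq, abs_lt]
        push_cast
        constructor <;> linarith) N
    have hpull : ∀ u : ℝ, R < |u| → LZ (pull (fun y : Y => (y, u)) b) := fun u hu => by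
      filter_upwards [eventually_image (uniformContinuous_slice u) hbs] with s h1
      by_contra hne
      obtain ⟨t, ht, -, hn⟩ := pull_ne_zero hne
      obtain ⟨⟨x, hx⟩, -, h2⟩ := h1 t ht.subset hn
      obtain ⟨y, -, rfl⟩ := ht.subset hx
      exact absurd (hKR _ (h2 hx)).2 (not_le.2 hu)
    have hp1 := neg_abs_le p.2
    have hp2 := le_abs_self p.2
    have h0 : LZ (g + pull (fun y : Y => (y, u₁ + (0 : ℕ) * (η / 2))) (h + b)) := by
      have h1 : pull (fun y : Y => (y, u₁)) h = g := by
        funext s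
        have h4 : pull (fun y : Y => (y, u₁)) h s = pull (fun y : Y => (y, u₁)) (pull Prod.fst g) s := by
          refine pull_congr fun t ht => hpos _ fun x hx => ?_
          obtain ⟨y, -, rfl⟩ := ht.subset hx
          simp only [u₁]; linarith
        rw [h4, pull_comp]
        exact congrFun (pull_id g) s
      have h5 := hpull u₁ (by rw [lt_abs]; right; simp only [u₁]; linarith)
      rw [pull_add, Nat.cast_zero, zero_mul, add_zero, h1, ← add_assoc]
      refine LZ.add ?_ h5
      exact Eventually.of_forall fun s => ZModModule.add_self _
    have h1 : LZ (pull (fun y : Y => (y, u₁ + (N : ℕ) * (η / 2))) (h + b)) := by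
      rw [pull_add]
      refine LZ.add ?_ (hpull _ (by rw [lt_abs]; left; simp only [u₁]; linarith))
      filter_upwards [eventually_image (uniformContinuous_slice _) hh] with s h1
      by_contra hne
      obtain ⟨t, ht, -, hn⟩ := pull_ne_zero hne
      obtain ⟨⟨x, hx⟩, -, h2⟩ := h1 t ht.subset hn
      have h3 := (h2 x hx).2
      obtain ⟨y, -, rfl⟩ := ht.subset hx
      simp only [u₁] at h3
      linarith
    refine hgn ⟨q, ⟨Kg ∪ cthickening 1 L ∪ Kg ∪ cthickening 1 (Kg ∪ L), ?_, Set.subset_univ _, ?_⟩, ?_⟩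
    · exact ((hKg.union hL.cthickening).union hKg).union (hKg.union hL).cthickening
    · filter_upwards [hqs, eventually_sm one_pos] with s h2 h3 h4
      obtain ⟨j, -, t, ht, hc, hn, h5⟩ := h2 h4
      obtain ⟨⟨x, hx⟩, h6, h7⟩ := h5 hn
      obtain ⟨y, hy, h8⟩ : ∃ y ∈ s, y ∈ Kg ∪ L := by
        have h9 := h7 x hx
        rcases ht hx with ⟨y, hy, rfl⟩ | ⟨y, hy, rfl⟩ <;> exact ⟨y, hy, h9⟩
      refine ⟨⟨y, hy⟩, by omega, fun w hw => .inr ?_⟩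
      exact mem_cthickening_of_dist_le _ _ _ _ h8 (h3 w hw y hy).le
    · convert (h0.add h1).add hq using 1
      funext s
      simp only [Pi.add_apply]
      grind

lemma hasCover_pi (n : ℕ) {K : Set (Fin n → ℝ)} (hK : IsCompact K) {ε : ℝ} (hε : 0 < ε) :
    HasCover (n + 1) K ε := by
  refine hasCover_of_measure_zero hK ?_ hε
  have h := hausdorffMeasure_of_dimH_lt (s := K) (d := n + 1) ?_
  · simpa using h
  · refine (dimH_mono (Set.subset_univ K)).trans_lt ?_
    rw [Real.dimH_univ_pi_fin]
    exact_mod_cast Nat.lt_succ_self n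

lemma good_of_unique {X : Type*} [MetricSpace X] [Unique X] : Good 0 (Set.univ : Set X) := by
  have hsm : ∀ s : Finset X, s.Nonempty → s = {default} := fun s hs => by
    ext x
    rw [Unique.eq_default x]
    simp only [Finset.mem_singleton, iff_true]
    obtain ⟨y, hy⟩ := hs
    rwa [← Unique.eq_default y]
  have hLZ : ∀ {a : Coch X}, IsCochain 1 Set.univ a → a {default} = 0 → LZ a := by
    rintro a ⟨K, -, -, h⟩ h0
    filter_upwards [h] with s hs
    by_contra hne
    rw [hsm s (hs hne).1] at hne
    exact hne h0
  refine ⟨isOpen_univ, fun a a' ha ha' => ?_, fun p _ O _ hp => ?_, fun K _ _ ε hε => ?_⟩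
  · by_cases h : a {default} = 0
    · exact .inl (.of_LZ (hLZ ha.1 h))
    by_cases h' : a' {default} = 0
    · exact .inr (.inl (.of_LZ (hLZ ha'.1 h')))
    refine .inr (.inr (.of_LZ (hLZ (ha.1.add' ha'.1) ?_)))
    rw [Pi.add_apply]
    generalize a {default} = x at *
    generalize a' {default} = y at *
    revert x y
    decide
  · refine ⟨fun s => if s.Nonempty then 1 else 0, ⟨⟨{p}, isCompact_singleton, by simpa using hp,
      Eventually.of_forall fun s hs => ?_⟩, Eventually.of_forall fun s => ?_⟩, ?_⟩
    · have h : s.Nonempty := by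
        by_contra hc
        exact hs (if_neg hc)
      rw [hsm s h, Unique.eq_default p]
      simp
    · rcases s.eq_empty_or_nonempty with rfl | h
      · simp [cob]
      · rw [hsm s h]
        simp only [cob, Finset.sum_singleton]
        exact if_neg (by simp)
    · rintro ⟨b, hb, hz⟩
      rw [add_comm] at hz
      obtain ⟨ε, hε, h⟩ := eventually_smalls.1 (hb.LZ_of_zero.cob.congr hz)
      have := h {default} fun x hx y hy => by
        rwa [Finset.mem_singleton.1 hx, Finset.mem_singleton.1 hy, dist_self]
      simp at this
  · refine ⟨1, fun _ => {default}, fun _ => isCompact_singleton, fun x _ => ?_, ?_, fun p => ?_⟩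
    · simp [Unique.eq_default x]
    · rintro i x rfl y rfl
      simpa using hε
    · exact (Finset.card_filter_le _ _).trans (by simp)

theorem good_pi (n : ℕ) : Good n (Set.univ : Set (Fin n → ℝ)) := by
  induction n with
  | zero => exact good_of_unique
  | succ n ih =>
    let e : (Fin n → ℝ) × ℝ ≃ₜ (Fin (n + 1) → ℝ) :=
      (Homeomorph.prodComm _ _).trans (Fin.consEquivL ℝ fun _ : Fin (n + 1) => ℝ).toHomeomorph
    have h : Good (n + 1) (Set.univ : Set ((Fin n → ℝ) × ℝ)) := by
      refine ⟨isOpen_univ, fun a a' => unique_prod ih, fun p _ O hO hp => ?_,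
        fun K _ hK ε hε => ?_⟩
      · rw [Set.inter_univ]
        exact exists_small_prod ih p hO hp
      · have hK' := e.isCompact_image.2 hK
        have := HasCover.image e.symm.isOpenEmbedding hK' (fun _ => hasCover_pi _ hK') hε
        rwa [← Set.image_comp, e.symm_comp_self, Set.image_id] at this
    have := h.range e.isOpenEmbedding
    rwa [e.surjective.range_eq] at this

end Euclidean

end SmallSimplices

/-! ### The top-degree class of a closed manifold modulo two -/

namespace SmallSimplices

open Filter Topology

section Degree

open scoped Classical

variable {M : Type*} [MetricSpace M]

lemma IsCochain.inter {k : ℕ} {U V : Set M} {a b : Coch M} (ha : IsCochain k U a)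
    (hb : IsCochain k V b) (hab : LZ (a + b)) : IsCochain k (U ∩ V) a := by
  obtain ⟨K, h1, h2, h3⟩ := ha
  obtain ⟨K', h1', h2', h3'⟩ := hb
  refine ⟨K ∩ K', h1.inter h1', Set.inter_subset_inter h2 h2', ?_⟩
  filter_upwards [h3, h3', hab] with s h4 h5 h6 h7
  have h8 : b s ≠ 0 := fun h => h7 (by simpa [h] using h6)
  exact ⟨(h4 h7).1, (h4 h7).2.1, Set.subset_inter (h4 h7).2.2 (h5 h8).2.2⟩

variable [ProperSpace M]

lemma IsCochain.split {k : ℕ} {U V : Set M} (hU : IsOpen U) (hV : IsOpen V) {a : Coch M}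
    (ha : IsCochain k (U ∪ V) a) : ∃ a₁ a₂, IsCochain k U a₁ ∧ IsCochain k V a₂ ∧ a = a₁ + a₂ := by
  obtain ⟨K, hK, hKUV, hs⟩ := ha
  obtain ⟨K₁, K₂, hK₁, hK₂, h1, h2, rfl⟩ := hK.binary_compact_cover hU hV hKUV
  refine ⟨fun s => if ∃ p ∈ s, p ∈ K₁ then a s else 0, fun s => if ∃ p ∈ s, p ∈ K₁ then 0 else a s,
    .of_near hK₁ h1 hU fun η hη => ?_, ⟨K₂, hK₂, h2, ?_⟩, ?_⟩
  · filter_upwards [hs, eventually_sm hη] with s h3 h4 h5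
    split_ifs at h5 with h
    · obtain ⟨p, hp, hpK⟩ := h
      exact ⟨(h3 h5).1, (h3 h5).2.1, subset_cthickening_of_sm h4 hp hpK⟩
    · exact absurd rfl h5
  · filter_upwards [hs] with s h3 h5
    split_ifs at h5 with h
    · exact absurd rfl h5
    · refine ⟨(h3 h5).1, (h3 h5).2.1, fun p hp => ?_⟩
      exact ((h3 h5).2.2 hp).resolve_left fun hpK => h ⟨p, hp, hpK⟩
  · funext s
    simp only [Pi.add_apply]
    split_ifs <;> simp

lemma Coc.split {n : ℕ} {U V : Set M} (hU : IsOpen U) (hV : IsOpen V)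
    (hc : ∀ K ⊆ U ∩ V, IsCompact K → ∀ ε > 0, HasCover (n + 1) K ε) {a : Coch M}
    (ha : Coc n (U ∪ V) a) : ∃ a₁ a₂, Coc n U a₁ ∧ Coc n V a₂ ∧ a = a₁ + a₂ := by
  obtain ⟨a₁, a₂, h1, h2, rfl⟩ := ha.1.split hU hV
  have hz := ha.2
  rw [cob_add] at hz
  have hcoc : Coc (n + 1) (U ∩ V) (SmallSimplices.cob a₁) :=
    ⟨(h1.cob hU).inter (h2.cob hV) hz, by rw [cob_cob]; exact .zero⟩
  obtain ⟨e, he, hez⟩ := bd_of_hasCover le_rfl (hU.inter hV) hc hcoc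
  refine ⟨a₁ + e, a₂ + e, ⟨h1.add' (he.mono Set.inter_subset_left), by rwa [cob_add]⟩,
    ⟨h2.add' (he.mono Set.inter_subset_right), ?_⟩, ?_⟩
  · rw [cob_add]
    convert hz.add hez using 1
    funext s
    simp only [Pi.add_apply]
    grind
  · funext s
    simp only [Pi.add_apply]
    grind

/-- There is a degree on the compactly supported top cocycles of `U` compatible with the classes
of all good sets. -/
def HasDeg (n : ℕ) (U : Set M) : Prop :=
  ∃ D : Coch M → ZMod 2, (∀ a b, Coc n U a → Coc n U b → D (a + b) = D a + D b) ∧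
    (∀ a, Coc n U a → Bd n U a → D a = 0) ∧
    ∀ b ⊆ U, Good n b → ∀ a, Coc n b a → ¬ Bd n b a → D a = 1

lemma nonempty_of_not_bd {n : ℕ} {b : Set M} {a : Coch M} (ha : Coc n b a) (h : ¬ Bd n b a) :
    b.Nonempty := by
  by_contra hb
  rw [Set.not_nonempty_iff_eq_empty] at hb
  subst hb
  obtain ⟨⟨K, hK, hKb, hs⟩, -⟩ := ha
  refine h (.of_LZ ?_)
  filter_upwards [hs] with s h1
  by_contra hne
  obtain ⟨⟨p, hp⟩, -, h3⟩ := h1 hne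
  exact hKb (h3 hp)

lemma Good.hasDeg {n : ℕ} {W : Set M} (hW : Good n W) : HasDeg n W := by
  refine ⟨fun a => if Bd n W a then 0 else 1, fun a b ha hb => ?_, fun a _ h => if_pos h,
    fun b hbW hb a ha hna => if_neg fun hBd => ?_⟩
  · beta_reduce
    by_cases h1 : Bd n W a
    · by_cases h2 : Bd n W b
      · simp [h1, h2, h1.add h2]
      · rw [if_pos h1, if_neg h2, if_neg fun h => h2 (h1.of_add h), zero_add]
    · by_cases h2 : Bd n W b
      · rw [if_neg h1, if_pos h2, if_neg fun h => h1 (h2.of_add (by rwa [add_comm])), add_zero]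
      · simp only [h1, h2, ((hW.unique a b ha hb).resolve_left h1).resolve_left h2, if_true,
          if_false]
        decide
  · obtain ⟨p, hp⟩ := nonempty_of_not_bd ha hna
    obtain ⟨g, hg, hgn⟩ := hW.exists_small p (hbW hp) b hb.isOpen hp
    have h1 := ((hb.unique a g ha (hg.mono Set.inter_subset_left)).resolve_left hna).resolve_left
      fun h => hgn (h.mono hbW)
    exact hgn (hBd.of_add (h1.mono hbW))

/-- The good sets form a basis of the topology. -/
def GoodBasis (n : ℕ) (M : Type*) [MetricSpace M] : Prop :=
  ∀ (p : M) (O : Set M), IsOpen O → p ∈ O → ∃ b ⊆ O, p ∈ b ∧ Good n b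

lemma Coc.lz_of_empty {n : ℕ} {a : Coch M} (h : Coc n ∅ a) : LZ a := by
  by_contra hz
  have : ¬ Bd n ∅ a := by
    rintro ⟨b, ⟨K, -, hK, hs⟩, h2⟩
    obtain rfl := Set.subset_empty_iff.1 hK
    have hb : LZ b := by
      filter_upwards [hs] with s h1
      by_contra hne
      obtain ⟨⟨p, hp⟩, -, h3⟩ := h1 hne
      exact h3 hp
    rw [add_comm] at h2
    exact hz (hb.cob.congr h2)
  exact Set.not_nonempty_empty (nonempty_of_not_bd h this)

lemma deg_eq_of_good {n : ℕ} (hM : GoodBasis n M) {U W : Set M} (hU : IsOpen U) (hW : Good n W)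
    {D₁ D₂ : Coch M → ZMod 2}
    (h₁ : ∀ a b, Coc n U a → Coc n U b → D₁ (a + b) = D₁ a + D₁ b)
    (h₁' : ∀ a, Coc n U a → Bd n U a → D₁ a = 0)
    (h₁'' : ∀ b ⊆ U, Good n b → ∀ a, Coc n b a → ¬ Bd n b a → D₁ a = 1)
    (h₂ : ∀ a b, Coc n W a → Coc n W b → D₂ (a + b) = D₂ a + D₂ b)
    (h₂' : ∀ a, Coc n W a → Bd n W a → D₂ a = 0)
    (h₂'' : ∀ b ⊆ W, Good n b → ∀ a, Coc n b a → ¬ Bd n b a → D₂ a = 1)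
    {a : Coch M} (ha : Coc n (U ∩ W) a) : D₁ a = D₂ a := by
  have hI : ∀ I : Finset (Set M), (∀ b ∈ I, b ⊆ U ∩ W ∧ Good n b) →
      ∀ a, Coc n (⋃ b ∈ I, b) a → D₁ a = D₂ a := by
    intro I
    induction I using Finset.induction_on with
    | empty =>
      intro _ a ha
      have hz : LZ a := by
        simp only [Finset.notMem_empty, Set.iUnion_of_empty, Set.iUnion_empty] at ha
        exact ha.lz_of_empty
      rw [h₁' a (ha.mono (by simp)) (.of_LZ hz), h₂' a (ha.mono (by simp)) (.of_LZ hz)]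
    | insert b I hb ih =>
      intro hI a ha
      rw [Finset.set_biUnion_insert] at ha
      have hbg := hI b (Finset.mem_insert_self _ _)
      have hI' : ∀ b ∈ I, b ⊆ U ∩ W ∧ Good n b := fun c hc => hI c (Finset.mem_insert_of_mem hc)
      have hIs : (⋃ b ∈ I, b) ⊆ U ∩ W := Set.iUnion₂_subset fun c hc => (hI' c hc).1
      obtain ⟨a₁, a₂, ha₁, ha₂, rfl⟩ := ha.split hbg.2.isOpen
        (isOpen_biUnion fun c hc => (hI' c hc).2.isOpen)
        fun K hK => hW.cover K ((hK.trans Set.inter_subset_left).trans (hbg.1.trans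
          Set.inter_subset_right))
      rw [h₁ _ _ (ha₁.mono (hbg.1.trans Set.inter_subset_left))
        (ha₂.mono (hIs.trans Set.inter_subset_left)),
        h₂ _ _ (ha₁.mono (hbg.1.trans Set.inter_subset_right))
        (ha₂.mono (hIs.trans Set.inter_subset_right)), ih hI' a₂ ha₂]
      congr 1
      by_cases hBd : Bd n b a₁
      · rw [h₁' _ (ha₁.mono (hbg.1.trans Set.inter_subset_left))
          (hBd.mono (hbg.1.trans Set.inter_subset_left)),
          h₂' _ (ha₁.mono (hbg.1.trans Set.inter_subset_right))
          (hBd.mono (hbg.1.trans Set.inter_subset_right))]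
      · rw [h₁'' b (hbg.1.trans Set.inter_subset_left) hbg.2 _ ha₁ hBd,
          h₂'' b (hbg.1.trans Set.inter_subset_right) hbg.2 _ ha₁ hBd]
  obtain ⟨⟨K, hK, hKUW, hs⟩, hz⟩ := ha
  choose! B hB1 hB2 hB3 using fun p (hp : p ∈ U ∩ W) => hM p (U ∩ W) (hU.inter hW.isOpen) hp
  obtain ⟨t, htK, hKt⟩ := hK.elim_nhds_subcover B
    fun p hp => (hB3 p (hKUW hp)).isOpen.mem_nhds (hB2 p (hKUW hp))
  refine hI (t.image B) ?_ a ⟨⟨K, hK, ?_, hs⟩, hz⟩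
  · intro b hb
    obtain ⟨p, hp, rfl⟩ := Finset.mem_image.1 hb
    exact ⟨hB1 p (hKUW (htK p hp)), hB3 p (hKUW (htK p hp))⟩
  · rwa [Finset.set_biUnion_finset_image]

lemma HasDeg.union {n : ℕ} (hM : GoodBasis n M) {U W : Set M} (hU : IsOpen U) (h : HasDeg n U)
    (hW : Good n W) : HasDeg n (U ∪ W) := by
  obtain ⟨D₁, h₁, h₁', h₁''⟩ := h
  obtain ⟨D₂, h₂, h₂', h₂''⟩ := hW.hasDeg
  have key : ∀ a₁ a₂, Coc n U a₁ → Coc n W a₂ → Bd n (U ∪ W) (a₁ + a₂) → D₁ a₁ = D₂ a₂ := by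
    rintro a₁ a₂ ha₁ ha₂ ⟨β, hβ, hz⟩
    obtain ⟨β₁, β₂, hβ₁, hβ₂, rfl⟩ := hβ.split hU hW.isOpen
    have hb₁ := Coc.cob hU hβ₁
    have hb₂ := Coc.cob hW.isOpen hβ₂
    have hg := ha₁.add hb₁
    have hg' := ha₂.add hb₂
    have hgg : LZ ((a₁ + cob β₁) + (a₂ + cob β₂)) := by
      rw [cob_add] at hz
      convert hz using 1
      abel
    have hUW : Coc n (U ∩ W) (a₁ + cob β₁) := ⟨hg.1.inter hg'.1 hgg, hg.2⟩
    have h3 := deg_eq_of_good hM hU hW h₁ h₁' h₁'' h₂ h₂' h₂'' hUW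
    have hgW := hUW.mono Set.inter_subset_right
    have h4 := h₂' _ (hgW.add hg') (.of_LZ hgg)
    rw [h₂ _ _ hgW hg', h₂ _ _ ha₂ hb₂, h₂' _ hb₂ (.cob hβ₂)] at h4
    rw [h₁ _ _ ha₁ hb₁, h₁' _ hb₁ (.cob hβ₁)] at h3
    grind
  have hex : ∀ a, Coc n (U ∪ W) a → ∃ a₁ a₂, Coc n U a₁ ∧ Coc n W a₂ ∧ a = a₁ + a₂ :=
    fun a ha => ha.split hU hW.isOpen fun K hK => hW.cover K (hK.trans Set.inter_subset_right)
  choose! A₁ A₂ hA₁ hA₂ hA using hex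
  have hD : ∀ a a₁ a₂, Coc n (U ∪ W) a → Coc n U a₁ → Coc n W a₂ → Bd n (U ∪ W) (a + (a₁ + a₂)) →
      D₁ (A₁ a) + D₂ (A₂ a) = D₁ a₁ + D₂ a₂ := by
    intro a a₁ a₂ ha ha₁ ha₂ hBd
    have h3 := key _ _ ((hA₁ a ha).add ha₁) ((hA₂ a ha).add ha₂) (by
      convert hBd using 1
      conv_rhs => rw [hA a ha]
      abel)
    rw [h₁ _ _ (hA₁ a ha) ha₁, h₂ _ _ (hA₂ a ha) ha₂] at h3
    grind
  have hadd : ∀ a b, Coc n (U ∪ W) a → Coc n (U ∪ W) b →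
      D₁ (A₁ (a + b)) + D₂ (A₂ (a + b)) = D₁ (A₁ a) + D₂ (A₂ a) + (D₁ (A₁ b) + D₂ (A₂ b)) := by
    intro a b ha hb
    have h3 := hD (a + b) _ _ (ha.add hb) ((hA₁ a ha).add (hA₁ b hb))
      ((hA₂ a ha).add (hA₂ b hb)) (.of_LZ (Eventually.of_forall fun s => by
        have e1 := congrFun (hA a ha) s
        have e2 := congrFun (hA b hb) s
        simp only [Pi.add_apply] at *
        grind))
    rw [h3, h₁ _ _ (hA₁ a ha) (hA₁ b hb), h₂ _ _ (hA₂ a ha) (hA₂ b hb)]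
    abel
  have hbd : ∀ a, Coc n (U ∪ W) a → Bd n (U ∪ W) a → D₁ (A₁ a) + D₂ (A₂ a) = 0 := by
    intro a ha hBd
    rw [hD a 0 0 ha .zero .zero (by simpa using hBd), h₁' 0 .zero (.of_LZ .zero),
      h₂' 0 .zero (.of_LZ .zero), add_zero]
  refine ⟨fun a => D₁ (A₁ a) + D₂ (A₂ a), hadd, hbd, fun b hbUW hb a ha hna => ?_⟩
  obtain ⟨p, hp⟩ := nonempty_of_not_bd ha hna
  have hself : ∀ g : Coch M, Bd n (U ∪ W) (g + g) := fun g =>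
    .of_LZ (Eventually.of_forall fun _ => ZModModule.add_self _)
  have hval : ∃ b' ⊆ b, IsOpen b' ∧ p ∈ b' ∧ ∀ g, Coc n b' g → ¬ Bd n b' g →
      D₁ (A₁ g) + D₂ (A₂ g) = 1 := by
    rcases hbUW hp with hpU | hpW
    · obtain ⟨b', hb', hpb', hg'⟩ := hM p (b ∩ U) (hb.isOpen.inter hU) ⟨hp, hpU⟩
      refine ⟨b', hb'.trans Set.inter_subset_left, hg'.isOpen, hpb', fun g hg hgn => ?_⟩
      have hbU := hb'.trans Set.inter_subset_right
      rw [hD g g 0 (hg.mono (hbU.trans Set.subset_union_left)) (hg.mono hbU) .zero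
        (by simpa using hself g), h₂' 0 .zero (.of_LZ .zero), add_zero, h₁'' b' hbU hg' g hg hgn]
    · obtain ⟨b', hb', hpb', hg'⟩ := hM p (b ∩ W) (hb.isOpen.inter hW.isOpen) ⟨hp, hpW⟩
      refine ⟨b', hb'.trans Set.inter_subset_left, hg'.isOpen, hpb', fun g hg hgn => ?_⟩
      have hbW := hb'.trans Set.inter_subset_right
      rw [hD g 0 g (hg.mono (hbW.trans Set.subset_union_right)) .zero (hg.mono hbW)
        (by simpa using hself g), h₁' 0 .zero (.of_LZ .zero), zero_add, h₂'' b' hbW hg' g hg hgn]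
  obtain ⟨b', hb'b, hb'o, hpb', hval⟩ := hval
  obtain ⟨g, hg, hgn⟩ := hb.exists_small p hp b' hb'o hpb'
  have hg1 := hval g (hg.mono Set.inter_subset_left) fun h => hgn (h.mono hb'b)
  have hag := ((hb.unique a g ha (hg.mono Set.inter_subset_right)).resolve_left hna).resolve_left hgn
  have hab := ha.mono hbUW
  have hgb := hg.mono (Set.inter_subset_right.trans hbUW)
  have h5 := hbd _ (hab.add hgb) (hag.mono hbUW)
  rw [hadd a g hab hgb, hg1] at h5
  grind

/-- The fundamental class of a closed manifold: local top classes are globally nonzero. -/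
theorem not_bd_univ [CompactSpace M] {n : ℕ} (hM : GoodBasis n M) {b : Set M} (hb : Good n b)
    {a : Coch M} (ha : Coc n b a) (hna : ¬ Bd n b a) : ¬ Bd n Set.univ a := by
  choose B hB1 hB2 hB3 using fun p : M => hM p Set.univ isOpen_univ trivial
  obtain ⟨t, ht⟩ := isCompact_univ.elim_nhds_subcover B
    fun p _ => (hB3 p).isOpen.mem_nhds (hB2 p)
  have hdeg : ∀ t : Finset M, HasDeg n (⋃ p ∈ t, B p) := by
    intro t
    induction t using Finset.induction_on with
    | empty =>
      refine ⟨fun _ => 0, fun _ _ _ _ => (add_zero 0).symm, fun _ _ _ => rfl,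
        fun b hb' _ a ha hna => ?_⟩
      obtain ⟨p, hp⟩ := nonempty_of_not_bd ha hna
      simpa using hb' hp
    | insert p t hp ih =>
      rw [Finset.set_biUnion_insert, Set.union_comm]
      exact ih.union hM (isOpen_biUnion fun q _ => (hB3 q).isOpen) (hB3 p)
  have hu : HasDeg n (Set.univ : Set M) := by
    have := hdeg t
    rwa [Set.univ_subset_iff.1 ht.2] at this
  obtain ⟨D, -, h1, h2⟩ := hu
  intro hBd
  have h3 := h1 a (ha.mono (Set.subset_univ _)) hBd
  rw [h2 b (Set.subset_univ _) hb a ha hna] at h3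
  exact one_ne_zero h3

end Degree

end SmallSimplices

namespace SmallSimplices

open Filter Topology

section Manifold

variable {M : Type*} [MetricSpace M] [ProperSpace M]

lemma exists_chart {n : ℕ} (h : IsTopManifold n M) {p : M} {O : Set M} (hO : IsOpen O)
    (hp : p ∈ O) : ∃ e : (Fin n → ℝ) → M, IsOpenEmbedding e ∧ Set.range e ⊆ O ∧
      p ∈ Set.range e := by
  obtain ⟨U, V, hU, hpU, hV, ⟨φ⟩⟩ := h p
  let ψ : V → M := fun v => (φ.symm v : M)
  have hψ : IsOpenEmbedding ψ := hU.isOpenEmbedding_subtypeVal.comp φ.symm.isOpenEmbedding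
  let c : EuclideanSpace ℝ (Fin n) := φ ⟨p, hpU⟩
  have hN : IsOpen (Subtype.val '' (ψ ⁻¹' O)) :=
    hV.isOpenEmbedding_subtypeVal.isOpenMap _ (hO.preimage hψ.continuous)
  have hcN : c ∈ Subtype.val '' (ψ ⁻¹' O) := ⟨φ ⟨p, hpU⟩, by simpa [ψ] using hp, rfl⟩
  obtain ⟨ρ, hρ, hρN⟩ := Metric.isOpen_iff.1 hN c hcN
  let B := OpenPartialHomeomorph.univBall c ρ
  have hBe : IsOpenEmbedding B :=
    B.isOpenEmbedding (OpenPartialHomeomorph.univBall_source c ρ)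
  have hBr : ∀ v, B v ∈ ball c ρ := fun v => by
    rw [← OpenPartialHomeomorph.univBall_target c hρ]
    exact B.map_source (by rw [OpenPartialHomeomorph.univBall_source]; trivial)
  have hBV : ∀ v, ∃ h : B v ∈ V, ψ ⟨B v, h⟩ ∈ O := fun v => by
    obtain ⟨w, hw, hwv⟩ := hρN (hBr v)
    have hBv : B v ∈ V := hwv ▸ w.2
    have hwe : w = ⟨B v, hBv⟩ := Subtype.ext hwv
    exact ⟨hBv, hwe ▸ hw⟩
  let B' : EuclideanSpace ℝ (Fin n) → V := fun v => ⟨B v, (hBV v).1⟩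
  have hB' : IsOpenEmbedding B' := IsOpenEmbedding.of_comp B' hV.isOpenEmbedding_subtypeVal hBe
  let E : (Fin n → ℝ) ≃ₜ EuclideanSpace ℝ (Fin n) :=
    (EuclideanSpace.equiv (Fin n) ℝ).symm.toHomeomorph
  have he : IsOpenEmbedding (ψ ∘ B' ∘ E) := hψ.comp (hB'.comp E.isOpenEmbedding)
  refine ⟨_, he, ?_, ?_⟩
  · rintro _ ⟨v, rfl⟩
    exact (hBV (E v)).2
  · refine ⟨E.symm 0, ?_⟩
    have h0 : B' 0 = φ ⟨p, hpU⟩ := Subtype.ext (OpenPartialHomeomorph.univBall_apply_zero c ρ)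
    simp [ψ, h0]

lemma goodBasis_of_isTopManifold {n : ℕ} (h : IsTopManifold n M) : GoodBasis n M := by
  intro p O hO hp
  obtain ⟨e, he, heO, hpe⟩ := exists_chart h hO hp
  exact ⟨_, heO, hpe, (good_pi n).range he⟩

lemma locallyConnectedSpace_of_isTopManifold {n : ℕ} (h : IsTopManifold n M) :
    LocallyConnectedSpace M := by
  refine locallyConnectedSpace_iff_subsets_isOpen_isConnected.2 fun p U hU => ?_
  obtain ⟨O, hOU, hO, hp⟩ := _root_.mem_nhds_iff.1 hU
  obtain ⟨e, he, heO, hpe⟩ := exists_chart h hO hp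
  exact ⟨_, heO.trans hOU, he.isOpen_range, hpe, isConnected_range he.continuous⟩

/-- On a closed connected manifold the top classes near any two points are cohomologous. -/
theorem exists_cohomologous [CompactSpace M] [ConnectedSpace M] {n : ℕ} (hM : GoodBasis n M)
    {x y : M} {U V : Set M} (hU : IsOpen U) (hx : x ∈ U) (hV : IsOpen V) (hy : y ∈ V) :
    ∃ g g', Coc n U g ∧ Coc n V g' ∧ ¬ Bd n Set.univ g ∧ Bd n Set.univ (g + g') := by
  obtain ⟨b, -, hxb, hb⟩ := hM x Set.univ isOpen_univ trivial
  obtain ⟨g, hg, hgn⟩ := hb.exists_small x hxb U hU hx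
  have hgu := not_bd_univ hM hb (hg.mono Set.inter_subset_right) hgn
  let S : Set M := {p | ∀ O, IsOpen O → p ∈ O → ∃ g', Coc n O g' ∧ Bd n Set.univ (g + g')}
  have hS : ∀ c, Good n c → ∀ g', Coc n c g' → Bd n Set.univ (g + g') → c ⊆ S := by
    intro c hc g' hg' hBd p hp O hO hpO
    obtain ⟨f, hf, hfn⟩ := hc.exists_small p hp O hO hpO
    refine ⟨f, hf.mono Set.inter_subset_left, ?_⟩
    have h1 := (hc.unique g' f hg' (hf.mono Set.inter_subset_right)).resolve_left fun h =>
      hgu ((h.mono (Set.subset_univ _)).of_add (by rwa [add_comm]))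
    have h2 := hBd.add ((h1.resolve_left hfn).mono (Set.subset_univ _))
    convert h2 using 1
    funext s
    simp only [Pi.add_apply]
    grind
  have hSg : ∀ c, Good n c → (c ∩ S).Nonempty → c ⊆ S := by
    rintro c hc ⟨p, hp, hpS⟩
    obtain ⟨g', hg', hBd⟩ := hpS c hc.isOpen hp
    exact hS c hc g' hg' hBd
  have hclopen : IsClopen S := by
    constructor
    · rw [← isOpen_compl_iff, isOpen_iff_mem_nhds]
      intro p hp
      obtain ⟨c, -, hpc, hc⟩ := hM p Set.univ isOpen_univ trivial
      filter_upwards [hc.isOpen.mem_nhds hpc] with q hq hqS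
      exact hp (hSg c hc ⟨q, hq, hqS⟩ hpc)
    · rw [isOpen_iff_mem_nhds]
      intro p hp
      obtain ⟨c, -, hpc, hc⟩ := hM p Set.univ isOpen_univ trivial
      exact Filter.mem_of_superset (hc.isOpen.mem_nhds hpc) (hSg c hc ⟨p, hpc, hp⟩)
  have hxS : x ∈ S := hS b hb g (hg.mono Set.inter_subset_right)
    (.of_LZ (Eventually.of_forall fun _ => ZModModule.add_self _)) hxb
  have hyS : y ∈ S := by
    rw [hclopen.eq_univ ⟨x, hxS⟩]; trivial
  obtain ⟨g', hg', hBd⟩ := hyS V hV hy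
  exact ⟨g, g', hg.mono Set.inter_subset_left, hg', hgu, hBd⟩

end Manifold

end SmallSimplices

/-! ### Fillings in linearly locally contractible spaces -/

namespace SmallSimplices

open Filter Topology
open scoped Classical

section Fill

variable {M : Type*} [MetricSpace M]

lemma mem_chainsIn_mono {A B : Finset M → Prop} {c : Chain M} (hc : c ∈ chainsIn {s | A s})
    (h : ∀ s, A s → B s) : c ∈ chainsIn {s | B s} :=
  chainsIn_mono h hc

lemma push_eq_self {f : M → M} {A : Set (Finset M)} (hf : ∀ s ∈ A, ∀ p ∈ s, f p = p) {c : Chain M}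
    (hc : c ∈ chainsIn A) : push f c = c := by
  have h := map_mem_of_chainsIn (F := push f + LinearMap.id) (P := ⊥) (fun s hs => ?_) hc
  · rw [Submodule.mem_bot] at h
    have h' : push f c + c = 0 := h
    calc push f c = push f c + (c + c) := by rw [ZModModule.add_self, add_zero]
      _ = c := by rw [← add_assoc, h', zero_add]
  · have h1 : Set.EqOn f id s := fun p hp => hf s hs p hp
    have h2 : s.image f = s := by
      rw [Finset.image_congr h1, Finset.image_id]
    rw [Submodule.mem_bot, LinearMap.add_apply, push_simplex,
      if_pos (h1.injOn_iff.2 (Set.injOn_id _)), h2]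
    exact ZModModule.add_self _

/-- A fine cycle near a point bounds a fine chain. -/
lemma exists_filling_at [ProperSpace M] {L : ℝ} (hM : IsLLC L M) {ρ ε : ℝ} (hρ : 0 < ρ)
    (hρd : ρ ≤ diam (Set.univ : Set M) / L) (hε : 0 < ε) (z : M) :
    ∃ η > 0, ∀ c ∈ chainsIn {s : Finset M | Sm η s ∧ (s : Set M) ⊆ ball z (ρ / 2)}, bd c = 0 →
      ∃ e ∈ chainsIn {s : Finset M | Sm ε s ∧ (s : Set M) ⊆ ball z (L * ρ)}, bd e = c := by
  obtain ⟨h, hc, h0, ⟨p, h1⟩, hb⟩ := hM z ρ hρ hρd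
  have hsub : closedBall z (ρ / 2) ⊆ ball z ρ := closedBall_subset_ball (by linarith)
  have hunif := (isCompact_Icc.prod (isCompact_closedBall z (ρ / 2))).uniformContinuousOn_of_continuous
    (hc.mono (Set.prod_mono_right hsub))
  obtain ⟨δ, hδ, hu⟩ := Metric.uniformContinuousOn_iff.1 hunif ε hε
  obtain ⟨N, hN⟩ := exists_nat_one_div_lt hδ
  have hN0 : (0 : ℝ) < N + 1 := by positivity
  refine ⟨δ, hδ, fun c hcc hbd => ?_⟩
  let f : ℕ → M → M := fun j => h (j / (N + 1))
  have hI : ∀ j ≤ N + 1, (j / (N + 1) : ℝ) ∈ Set.Icc (0 : ℝ) 1 := fun j hj =>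
    ⟨by positivity, (div_le_one hN0).2 (by exact_mod_cast hj)⟩
  have key : ∀ j ≤ N + 1, ∃ e ∈ chainsIn {s : Finset M | Sm ε s ∧ (s : Set M) ⊆ ball z (L * ρ)},
      bd e = push (f 0) c + push (f j) c := by
    intro j
    induction j with
    | zero => exact fun _ => ⟨0, zero_mem _, by rw [map_zero, ZModModule.add_self]⟩
    | succ j ih =>
      intro hj
      obtain ⟨e, he, hbe⟩ := ih (by omega)
      obtain ⟨T, hT, hTs⟩ := exists_chain_homotopy (f j) (f (j + 1))
      refine ⟨e + T c, add_mem he (map_mem_of_chainsIn (fun s hs => ?_) hcc), ?_⟩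
      · refine mem_chainsIn_mono (hTs s) ?_
        rintro t ⟨ht, -⟩
        have hi : ∀ q ∈ t, ∃ i ≤ N + 1, (i = j ∨ i = j + 1) ∧ ∃ a ∈ s, f i a = q := by
          intro q hq
          rcases ht hq with ⟨a, ha, rfl⟩ | ⟨a, ha, rfl⟩
          exacts [⟨j, by omega, .inl rfl, a, ha, rfl⟩, ⟨j + 1, hj, .inr rfl, a, ha, rfl⟩]
        constructor
        · intro q hq q' hq'
          obtain ⟨i, hiN, hi1, a, ha, rfl⟩ := hi q hq
          obtain ⟨i', hiN', hi1', a', ha', rfl⟩ := hi q' hq'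
          refine hu (i / (N + 1), a) ⟨hI i hiN, ball_subset_closedBall (hs.2 ha)⟩
            (i' / (N + 1), a') ⟨hI i' hiN', ball_subset_closedBall (hs.2 ha')⟩ ?_
          refine max_lt ?_ (hs.1 a ha a' ha')
          refine lt_of_le_of_lt ?_ hN
          rw [Real.dist_eq, ← sub_div, abs_div, abs_of_pos hN0]
          gcongr
          rcases hi1 with rfl | rfl <;> rcases hi1' with rfl | rfl <;> simp
        · intro q hq
          obtain ⟨i, hiN, hi1, a, ha, rfl⟩ := hi q hq
          exact hb _ (hI i hiN) a (hsub (ball_subset_closedBall (hs.2 ha)))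
      · have h2 := hT c
        rw [hbd, map_zero, add_zero] at h2
        rw [map_add, hbe, h2, add_assoc, ← add_assoc (push (f j) c), ZModModule.add_self, zero_add]
  obtain ⟨e, he, hbe⟩ := key (N + 1) le_rfl
  have hself : push (f 0) c = c := push_eq_self (fun s hs q hq => by
    simpa [f] using h0 q (hsub (ball_subset_closedBall (hs.2 hq)))) hcc
  have hconst : ∀ q ∈ ball z ρ, f (N + 1) q = p := fun q hq => by
    simp only [f]
    push_cast
    rw [div_self hN0.ne', h1 q hq]
  have hp : p ∈ ball z (L * ρ) := by
    rw [← h1 z (mem_ball_self hρ)]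
    exact hb 1 (by simp) z (mem_ball_self hρ)
  refine ⟨e + cone p (push (f (N + 1)) c), add_mem he ?_, ?_⟩
  · have h3 : push (f (N + 1)) c ∈ chainsIn {s : Finset M | (s : Set M) ⊆ {p}} := by
      refine map_mem_of_chainsIn (fun s hs => ?_) hcc
      rw [push_simplex]
      split_ifs
      · refine simplex_mem ?_
        intro q hq
        rw [Finset.coe_image] at hq
        obtain ⟨a, ha, rfl⟩ := hq
        exact hconst a (hsub (ball_subset_closedBall (hs.2 ha)))
      · exact zero_mem _
    refine map_mem_of_chainsIn (fun s hs => ?_) h3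
    rw [cone_simplex]
    split_ifs
    · exact zero_mem _
    · have h4 : ∀ q ∈ insert p s, q = p := fun q hq =>
        (Finset.mem_insert.1 hq).elim id fun h => hs h
      refine simplex_mem ⟨fun q hq q' hq' => ?_, fun q hq => ?_⟩
      · rwa [h4 q hq, h4 q' hq', dist_self]
      · rwa [h4 q hq]
  · rw [map_add, hbe, hself, bd_cone, bd_push, hbd, map_zero, map_zero, add_zero, add_assoc,
      ZModModule.add_self, add_zero]

/-- Uniform version of `exists_filling_at`. -/
lemma exists_filling [CompactSpace M] {L : ℝ} (hM : IsLLC L M) {ρ ε : ℝ} (hρ : 0 < ρ)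
    (hρd : ρ ≤ diam (Set.univ : Set M) / L) (hε : 0 < ε) :
    ∃ η > 0, ∀ z, ∀ c ∈ chainsIn {s : Finset M | Sm η s ∧ (s : Set M) ⊆ ball z (ρ / 4)},
      bd c = 0 → ∃ e ∈ chainsIn {s : Finset M | Sm ε s ∧ (s : Set M) ⊆ ball z ((L + 1) * ρ)},
        bd e = c := by
  choose η hη h using exists_filling_at hM hρ hρd hε
  obtain ⟨t, -, ht⟩ := isCompact_univ.elim_nhds_subcover (fun z : M => ball z (ρ / 4))
    fun z _ => ball_mem_nhds z (by positivity)
  obtain ⟨δ, hδ, hδt⟩ : ∃ δ > 0, ∀ z ∈ t, δ ≤ η z := by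
    rcases t.eq_empty_or_nonempty with rfl | hne
    · exact ⟨1, one_pos, by simp⟩
    · exact ⟨t.inf' hne η, (Finset.lt_inf'_iff hne).2 fun z _ => hη z,
        fun z hz => Finset.inf'_le _ hz⟩
  refine ⟨δ, hδ, fun z c hc hbd => ?_⟩
  obtain ⟨w, hw, hzw⟩ := Set.mem_iUnion₂.1 (ht (Set.mem_univ z))
  rw [mem_ball] at hzw
  obtain ⟨e, he, hbe⟩ := h w c (mem_chainsIn_mono hc fun s hs => ⟨hs.1.mono (hδt w hw),
    hs.2.trans (ball_subset_ball' (by linarith))⟩) hbd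
  refine ⟨e, mem_chainsIn_mono he fun s hs => ⟨hs.1, hs.2.trans (ball_subset_ball' ?_)⟩, hbe⟩
  rw [dist_comm]
  linarith

/-- The radius (relative to the mesh) needed to fill simplices with `N` vertices. -/
noncomputable def rad (L : ℝ) : ℕ → ℝ
  | 0 => 1
  | N + 1 => 4 * (L + 1) * (rad L N + 1) + 1

lemma one_le_rad {L : ℝ} (hL : 1 ≤ L) (N : ℕ) : 1 ≤ rad L N := by
  induction N with
  | zero => exact le_rfl
  | succ N ih => simp only [rad]; nlinarith

lemma rad_le_succ {L : ℝ} (hL : 1 ≤ L) (N : ℕ) : rad L N ≤ rad L (N + 1) := by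
  have := one_le_rad hL N
  simp only [rad]
  nlinarith

/-- Coarse simplices can be replaced by fine chains, compatibly with boundaries. -/
lemma exists_fill [CompactSpace M] {L : ℝ} (hL : 1 ≤ L) (hM : IsLLC L M) {κ : ℝ} (hκ : 0 < κ)
    (N : ℕ) (hd : rad L N * κ ≤ diam (Set.univ : Set M)) {ε : ℝ} (hε : 0 < ε) :
    ∃ η > 0, ∃ F : Finset M → Chain M, ∀ s, Sm κ s → s.card ≤ N →
      (Sm η s → F s = simplex s) ∧
      F s ∈ chainsIn {t : Finset M | Sm ε t ∧ ∀ p ∈ s, (t : Set M) ⊆ ball p (rad L N * κ)} ∧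
      bd (F s) = ∑ v ∈ s, F (s.erase v) := by
  induction N generalizing ε with
  | zero =>
    refine ⟨1, one_pos, simplex, fun s hs h0 => ?_⟩
    obtain rfl : s = ∅ := Finset.card_eq_zero.1 (by omega)
    exact ⟨fun _ => rfl, simplex_mem ⟨by simp [Sm], by simp⟩, by simp⟩
  | succ N ih =>
    have hr := one_le_rad hL N
    have hr1 := rad_le_succ hL N
    have hstep : 4 * (L + 1) * (rad L N * κ + κ) + κ = rad L (N + 1) * κ := by
      simp only [rad]; ring
    obtain ⟨δ, hδ, hfill⟩ := exists_filling hM (ρ := 4 * (rad L N * κ + κ)) (by positivity)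
      ((le_div_iff₀ (by linarith)).2 (by nlinarith [mul_pos (lt_of_lt_of_le one_pos hr) hκ])) hε
    obtain ⟨η, hη, F, hF⟩ := ih ((mul_le_mul_of_nonneg_right hr1 hκ.le).trans hd)
      (lt_min hε hδ)
    have hex : ∀ s : Finset M, ∃ w, Sm κ s → s.card = N + 1 →
        (Sm (min η ε) s → w = simplex s) ∧
        w ∈ chainsIn {t : Finset M | Sm ε t ∧ ∀ p ∈ s, (t : Set M) ⊆ ball p (rad L (N + 1) * κ)} ∧
        bd w = ∑ v ∈ s, F (s.erase v) := by
      intro s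
      by_cases hs : Sm κ s ∧ s.card = N + 1
      swap
      · exact ⟨0, fun h1 h2 => (hs ⟨h1, h2⟩).elim⟩
      obtain ⟨hs, hsc⟩ := hs
      have her : ∀ v ∈ s, Sm κ (s.erase v) ∧ (s.erase v).card ≤ N := fun v hv =>
        ⟨hs.subset (Finset.erase_subset _ _), by rw [Finset.card_erase_of_mem hv]; omega⟩
      by_cases hfine : Sm (min η ε) s
      · refine ⟨simplex s, fun _ _ => ⟨fun _ => rfl, simplex_mem ⟨hfine.mono (min_le_right _ _),
          fun p hp q hq => (hs q hq p hp).trans_le ?_⟩, ?_⟩⟩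
        · nlinarith
        · rw [bd_simplex]
          refine Finset.sum_congr rfl fun v hv => ?_
          exact ((hF _ (her v hv).1 (her v hv).2).1
            ((hfine.mono (min_le_left _ _)).subset (Finset.erase_subset _ _))).symm
      · have hne : s.Nontrivial := by
          by_contra h
          rw [← Finset.one_lt_card_iff_nontrivial, not_lt, Finset.card_le_one] at h
          refine hfine fun p hp q hq => ?_
          rw [h p hp q hq, dist_self]
          exact lt_min hη hε
        obtain ⟨p, hp⟩ := hne.nonempty
        have hcyc : bd (∑ v ∈ s, F (s.erase v)) = 0 := by
          have hz := congrArg (Finsupp.linearCombination (ZMod 2) F) (bd_bd (simplex s))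
          have hτ : ∀ t, Finsupp.linearCombination (ZMod 2) F (simplex t) = F t := fun t => by
            simp [simplex]
          rw [map_sum, Finset.sum_congr rfl fun v hv => (hF _ (her v hv).1 (her v hv).2).2.2]
          simpa [hτ, map_sum] using hz
        have hmem : ∑ v ∈ s, F (s.erase v) ∈ chainsIn {t : Finset M | Sm δ t ∧
            (t : Set M) ⊆ ball p (4 * (rad L N * κ + κ) / 4)} := by
          refine Submodule.sum_mem _ fun v hv => ?_
          refine mem_chainsIn_mono (hF _ (her v hv).1 (her v hv).2).2.1
            fun t ht => ⟨ht.1.mono (min_le_right _ _), ?_⟩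
          obtain ⟨q, hq, hqv⟩ := hne.exists_ne v
          refine (ht.2 q (Finset.mem_erase.2 ⟨hqv, hq⟩)).trans (ball_subset_ball' ?_)
          have := hs q hq p hp
          linarith
        obtain ⟨w, hw, hbw⟩ := hfill p _ hmem hcyc
        refine ⟨w, fun _ _ => ⟨fun h => (hfine h).elim, mem_chainsIn_mono hw fun t ht =>
          ⟨ht.1, fun q hq => ht.2.trans (ball_subset_ball' ?_)⟩, hbw⟩⟩
        have := hs p hp q hq
        linarith
    choose G hG using hex
    have hlow : ∀ s : Finset M, ∀ v ∈ s, s.card ≤ N + 1 → (s.erase v).card ≠ N + 1 :=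
      fun s v hv hs => by rw [Finset.card_erase_of_mem hv]; have := Finset.card_pos.2 ⟨v, hv⟩; omega
    refine ⟨min η ε, lt_min hη hε, fun s => if s.card = N + 1 then G s else F s,
      fun s hs hsc => ?_⟩
    have hsum : ∑ v ∈ s, (fun s => if s.card = N + 1 then G s else F s) (s.erase v)
        = ∑ v ∈ s, F (s.erase v) :=
      Finset.sum_congr rfl fun v hv => if_neg (hlow s v hv hsc)
    rw [hsum]
    beta_reduce
    by_cases h : s.card = N + 1
    · simp only [if_pos h]
      exact hG s hs h
    · simp only [if_neg h]
      obtain ⟨h1, h2, h3⟩ := hF s hs (by omega)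
      refine ⟨fun hf => h1 (hf.mono (min_le_left _ _)), mem_chainsIn_mono h2 fun t ht =>
        ⟨ht.1.mono (min_le_left _ _), fun p hp => (ht.2 p hp).trans (ball_subset_ball ?_)⟩, h3⟩
      exact mul_le_mul_of_nonneg_right hr1 hκ.le

end Fill

end SmallSimplices

/-! ### Separating sets -/

namespace SmallSimplices

open Filter Topology
open scoped Classical

section Separate

variable {M : Type*} [MetricSpace M] [CompactSpace M]

/-- A cochain in degree `m` that is closed near a set covered with multiplicity `m` is, up to a
coboundary, zero near that set. -/
lemma exists_vanishing {L : ℝ} (hL : 1 ≤ L) (hM : IsLLC L M) {m : ℕ} {r : ℝ} (hr : 0 < r)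
    (hrd : r ≤ diam (Set.univ : Set M)) {S : Set M}
    (hS : HasCover m S (r / (32 * rad L (m + 2)))) {β : Coch M}
    (hβ : IsCochain (m + 1) Set.univ β)
    (hcob : ∀ᶠ s : Finset M in smalls M, (s : Set M) ⊆ thickening (r / 2) S → cob β s = 0) :
    ∃ c : Coch M, (∀ s, c s ≠ 0 → s.card = m) ∧ ∃ τ > 0, ∀ᶠ s : Finset M in smalls M,
      (s : Set M) ⊆ thickening τ S → (β + cob c) s = 0 := by
  have hR := one_le_rad hL (m + 2)
  set R := rad L (m + 2)
  have hR0 : 0 < R := by linarith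
  have hκ : 0 < r / (4 * R) := by positivity
  have hδ : 0 < r / (32 * R) := by positivity
  have hκδ : r / (4 * R) = 8 * (r / (32 * R)) := by field_simp; ring
  have hRκ : R * (r / (4 * R)) = r / 4 := by field_simp
  have hκr : r / (4 * R) ≤ r / 4 := by
    rw [div_le_div_iff₀ (by positivity) (by norm_num)]
    nlinarith
  set κ := r / (4 * R)
  set δ := r / (32 * R)
  obtain ⟨τ₀, hτ₀, f, hf, hfc⟩ := exists_collapse hδ hS
  obtain ⟨ε, hε, hcob'⟩ := eventually_smalls.1 hcob
  obtain ⟨η, hη, F, hF⟩ := exists_fill hL hM hκ (m + 2) (by rw [hRκ]; linarith) hε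
  rw [hRκ] at hF
  let b : Coch M := fun s => ev β (F s)
  have hcobb : ∀ t : Finset M, t.Nonempty → Sm κ t → t.card ≤ m + 2 →
      (t : Set M) ⊆ thickening (r / 4) S → cob b t = 0 := by
    rintro t ⟨p, hp⟩ htκ htc htS
    obtain ⟨-, h2, h3⟩ := hF t htκ htc
    have h4 : cob b t = ev (cob β) (F t) := by
      rw [ev_cob, h3, map_sum]; rfl
    rw [h4]
    refine ev_eq_zero (fun u hu => hcob' u hu.1 fun q hq => ?_) h2
    obtain ⟨z, hz, hpz⟩ := mem_thickening_iff.1 (htS hp)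
    refine mem_thickening_iff.2 ⟨z, hz, ?_⟩
    have h5 : dist q p < r / 4 := hu.2 p hp hq
    have := dist_triangle q p z
    linarith
  obtain ⟨T, hT, hTs⟩ := exists_homotopy (id : M → M) f
  refine ⟨fun s => if s.card = m then T b s else 0, fun s h => by
    by_contra h'; exact h (if_neg h'), min τ₀ δ, lt_min hτ₀ hδ, ?_⟩
  obtain ⟨_, -, -, hβs⟩ := hβ
  filter_upwards [hβs, eventually_sm hη, eventually_sm hδ, eventually_sm hτ₀] with s h1 h2 h3 h4
  intro hsS
  have hsκ : Sm κ s := h3.mono (by linarith)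
  by_cases hc : s.card = m + 1
  swap
  · have h5 : β s = 0 := by
      by_contra h; exact hc (h1 h).2.1
    have h6 : cob (fun s => if s.card = m then T b s else 0) s = 0 := by
      by_contra h
      obtain ⟨v, hv, t, -, htc, -, ht⟩ := cob_ne_zero h
      have : t.card = m := by
        by_contra h'; exact ht (if_neg h')
      omega
    rw [Pi.add_apply, h5, h6, add_zero]
  have h5 : cob (fun s => if s.card = m then T b s else 0) s = cob (T b) s :=
    cob_congr fun t _ htc => if_pos (by omega)
  have h6 : b s = β s := by
    simp only [b]
    rw [(hF s hsκ (by omega)).1 h2, ev_simplex]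
  have h7 : pull f b s = 0 := by
    by_contra h
    obtain ⟨t, ht, htc, -⟩ := pull_ne_zero h
    have h8 := hfc s (hsS.trans (thickening_mono (min_le_left _ _) _)) h4
    have h9 : t = s.image f := by
      rw [← Finset.coe_inj, ht, Finset.coe_image]
    rw [← h9, htc] at h8
    omega
  have h8 : T (cob b) s = 0 := by
    by_contra h
    obtain ⟨t, ht, htc, hbt⟩ := hTs _ _ h
    have hnear : ∀ q ∈ t, ∃ p ∈ s, dist q p < 2 * δ := by
      intro q hq
      rcases ht hq with ⟨p, hp, rfl⟩ | ⟨p, hp, rfl⟩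
      · exact ⟨p, hp, by simp only [id, dist_self]; linarith⟩
      · exact ⟨p, hp, by rw [dist_comm]; exact hf p⟩
    refine hbt (hcobb t (Finset.card_pos.1 (by omega)) (fun q hq q' hq' => ?_) (by omega)
      fun q hq => ?_)
    · obtain ⟨p, hp, hqp⟩ := hnear q hq
      obtain ⟨p', hp', hqp'⟩ := hnear q' hq'
      have := h3 p hp p' hp'
      have := dist_triangle4 q p p' q'
      rw [dist_comm p' q'] at this
      linarith
    · obtain ⟨p, hp, hqp⟩ := hnear q hq
      obtain ⟨z, hz, hpz⟩ := mem_thickening_iff.1 (hsS hp)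
      have := min_le_right τ₀ δ
      refine mem_thickening_iff.2 ⟨z, hz, ?_⟩
      have := dist_triangle q p z
      linarith
  have h9 := congrFun (hT b) s
  rw [Pi.add_apply, Pi.add_apply, pull_id, h7, h8, h6] at h9
  rw [Pi.add_apply, h5, ← add_zero (cob (T b) s), ← h9, add_zero, ZModModule.add_self]

/-- A class supported on one side of a set is trivial if it is cohomologous to a class supported
on the other side through a cochain vanishing near the set. -/
lemma bd_of_separated {n : ℕ} {S U V W : Set M} (hU : IsOpen U)
    (hUS : closure U ⊆ U ∪ S) (hVU : V ⊆ U) (hW : Disjoint W U) {g g' β : Coch M}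
    (hg : IsCochain (n + 1) V g) (hg' : IsCochain (n + 1) W g') (hβ : IsCochain n Set.univ β)
    (h : LZ (g + g' + cob β)) {τ : ℝ} (hτ : 0 < τ)
    (hβS : ∀ᶠ s : Finset M in smalls M, (s : Set M) ⊆ thickening τ S → β s = 0) :
    Bd n Set.univ g := by
  have hsep : ∃ δ > 0, ∀ p ∈ U, ∀ q ∉ U, dist p q < δ → p ∈ thickening (τ / 2) S := by
    have hK : IsCompact (closure U \ thickening (τ / 2) S) :=
      (isClosed_closure.sdiff isOpen_thickening).isCompact
    have hKU : closure U \ thickening (τ / 2) S ⊆ U := by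
      rintro p ⟨hp, hpS⟩
      exact (hUS hp).resolve_right fun h => hpS (self_subset_thickening (by positivity) S h)
    obtain ⟨δ, hδ, hδU⟩ := hK.exists_thickening_subset_open hU hKU
    refine ⟨δ, hδ, fun p hp q hq hpq => ?_⟩
    by_contra hpS
    exact hq (hδU (mem_thickening_iff.2 ⟨p, ⟨subset_closure hp, hpS⟩, by rwa [dist_comm]⟩))
  obtain ⟨δ, hδ, hsep⟩ := hsep
  refine ⟨fun s => if (s : Set M) ⊆ U then β s else 0, hβ.restrict _, ?_⟩
  obtain ⟨K, -, hKV, hgK⟩ := hg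
  obtain ⟨K', -, hKW, hgK'⟩ := hg'
  obtain ⟨_, -, -, hβn⟩ := hβ
  filter_upwards [hgK, hgK', eventually_subset hβn, h, eventually_subset hβS, eventually_sm hδ,
    eventually_sm (half_pos hτ)] with s h1 h2 h3 h4 h5 h6 h7
  have hgU : ¬ (s : Set M) ⊆ U → g s = 0 := fun hs => by
    by_contra hne
    exact hs ((h1 hne).2.2.trans (hKV.trans hVU))
  by_cases hsU : (s : Set M) ⊆ U
  · have h8 : g' s = 0 := by
      by_contra hne
      obtain ⟨⟨p, hp⟩, -, hs⟩ := h2 hne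
      exact Set.disjoint_left.1 hW (hKW (hs hp)) (hsU hp)
    have h9 : cob (fun s => if (s : Set M) ⊆ U then β s else 0) s = cob β s :=
      cob_congr fun t ht _ => if_pos ((Finset.coe_subset.2 ht).trans hsU)
    rw [Pi.add_apply, Pi.add_apply, h8, add_zero] at h4
    rw [Pi.add_apply, h9, h4]
  · rw [Pi.add_apply, hgU hsU, zero_add]
    by_contra hne
    obtain ⟨v, hv, t, hts, -, -, ht⟩ := cob_ne_zero hne
    have htU : (t : Set M) ⊆ U := by
      by_contra h'; exact ht (if_neg h')
    rw [if_pos htU] at ht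
    obtain ⟨p, hp⟩ := (h3 t hts ht).1
    obtain ⟨q, hq, hqU⟩ := Set.not_subset.1 hsU
    have hpS := hsep p (htU hp) q hqU (h6 p (hts hp) q hq)
    obtain ⟨z, hz, hpz⟩ := mem_thickening_iff.1 hpS
    refine ht (h5 t hts fun q hq => mem_thickening_iff.2 ⟨z, hz, ?_⟩)
    have := h7 q (hts hq) p (hts hp)
    have := dist_triangle q p z
    linarith

/-- A separating set far from the two separated points has no fine cover of small
multiplicity. -/
theorem not_hasCover_of_separates [ConnectedSpace M] {L : ℝ} (hL : 1 ≤ L) {m : ℕ}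
    (hM : IsTopManifold (m + 1) M) (hLLC : IsLLC L M) {S : Set M} {x y : M} {r : ℝ}
    (hS : IsClosed S) (hr : 0 < r) (hx : x ∈ Sᶜ) (hy : y ∈ Sᶜ)
    (hxy : connectedComponentIn Sᶜ x ≠ connectedComponentIn Sᶜ y)
    (hxS : ∀ s ∈ S, r ≤ dist s x) (hyS : ∀ s ∈ S, r ≤ dist s y) :
    ¬ HasCover m S (r / (32 * rad L (m + 2))) := by
  intro hcov
  have := locallyConnectedSpace_of_isTopManifold hM
  have hne : S.Nonempty := by
    by_contra h
    rw [Set.not_nonempty_iff_eq_empty] at h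
    subst h
    simp [connectedComponentIn_univ] at hxy
  obtain ⟨s₀, hs₀⟩ := hne
  have hrd : r ≤ diam (Set.univ : Set M) :=
    (hxS s₀ hs₀).trans (dist_le_diam_of_mem isCompact_univ.isBounded trivial trivial)
  set U := connectedComponentIn Sᶜ x with hUdef
  have hU : IsOpen U := hS.isOpen_compl.connectedComponentIn
  have hV : IsOpen (connectedComponentIn Sᶜ y) := hS.isOpen_compl.connectedComponentIn
  have hUS : closure U ⊆ U ∪ S := by
    intro p hp
    by_contra h
    rw [Set.mem_union, not_or] at h
    obtain ⟨q, hq, hqU⟩ := mem_closure_iff.1 hp _ hS.isOpen_compl.connectedComponentIn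
      (mem_connectedComponentIn h.2)
    rw [hUdef, connectedComponentIn_eq hqU, ← connectedComponentIn_eq hq] at h
    exact h.1 (mem_connectedComponentIn h.2)
  obtain ⟨g, g', hg, hg', hgn, β, hβ, hgβ⟩ := exists_cohomologous (goodBasis_of_isTopManifold hM)
    (hU.inter isOpen_ball) ⟨mem_connectedComponentIn hx, mem_ball_self (ε := r / 2) (by positivity)⟩
    (hV.inter isOpen_ball) ⟨mem_connectedComponentIn hy, mem_ball_self (ε := r / 2) (by positivity)⟩
  have hfar : ∀ z : M, (∀ s ∈ S, r ≤ dist s z) → ∀ {K O : Set M}, K ⊆ O ∩ ball z (r / 2) →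
      ∀ s : Finset M, s.Nonempty → (s : Set M) ⊆ K → ¬ (s : Set M) ⊆ thickening (r / 2) S := by
    rintro z hz K O hK s ⟨p, hp⟩ hs hsS
    obtain ⟨w, hw, hpw⟩ := mem_thickening_iff.1 (hsS hp)
    have h1 : dist p z < r / 2 := (hK (hs hp)).2
    have h2 := hz w hw
    have := dist_triangle_left w z p
    linarith
  have hcob : ∀ᶠ s : Finset M in smalls M, (s : Set M) ⊆ thickening (r / 2) S → cob β s = 0 := by
    obtain ⟨⟨K, -, hK, h1⟩, -⟩ := hg
    obtain ⟨⟨K', -, hK', h2⟩, -⟩ := hg'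
    filter_upwards [h1, h2, hgβ] with s h1 h2 h3
    intro hsS
    have h4 : g s = 0 := by
      by_contra h
      exact hfar x hxS hK s (h1 h).1 (h1 h).2.2 hsS
    have h5 : g' s = 0 := by
      by_contra h
      exact hfar y hyS hK' s (h2 h).1 (h2 h).2.2 hsS
    simpa [h4, h5] using h3
  obtain ⟨c, hc, τ, hτ, hcτ⟩ := exists_vanishing hL hLLC hr hrd hcov hβ hcob
  have hm : m ≠ 0 := by
    rintro rfl
    obtain ⟨N, V, -, hSV, -, hV⟩ := hcov
    obtain ⟨i, hi⟩ := Set.mem_iUnion.1 (hSV hs₀)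
    have hi' : i ∈ Finset.univ.filter fun i => s₀ ∈ V i := by simpa using hi
    exact absurd (hV s₀) (not_le.2 (Finset.card_pos.2 ⟨i, hi'⟩))
  have hcc : IsCochain m Set.univ c := by
    refine ⟨Set.univ, isCompact_univ, subset_rfl, Eventually.of_forall fun s hs => ?_⟩
    have := hc s hs
    exact ⟨Finset.card_pos.1 (by omega), this, Set.subset_univ _⟩
  have hdisj : Disjoint (connectedComponentIn Sᶜ y ∩ ball y (r / 2)) U :=
    Set.disjoint_left.2 fun p h1 h2 =>
      hxy ((connectedComponentIn_eq h2).trans (connectedComponentIn_eq h1.1).symm)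
  refine hgn (bd_of_separated hU hUS Set.inter_subset_left hdisj hg.1 hg'.1
    (hβ.add' (hcc.cob isOpen_univ)) ?_ hτ hcτ)
  rwa [cob_add, cob_cob, add_zero]

end Separate

end SmallSimplices

/-- **Theorem 1.4.** There is `c > 0` depending only on `n`, `D`, `L` such that for every
closed, connected, `D`-doubling, `L`-linearly locally contractible metric `n`-manifold `M`:
if a closed set `S ⊆ M` separates two points `x, y` (they lie in different connected
components of `M \ S`) with `dist(S, {x,y}) ≥ r`, then `H_{n-1}(S) ≥ c ⋅ r^{n-1}`. -/
theorem separating_set_measure_lower_bound (n D : ℕ) (L : ℝ)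
    (hn : 1 ≤ n) (hD : 1 ≤ D) (hL : 1 ≤ L) :
    ∃ c : ℝ, 0 < c ∧
      ∀ (M : Type) [MetricSpace M] [CompactSpace M] [ConnectedSpace M]
        [MeasurableSpace M] [BorelSpace M],
        IsTopManifold n M → IsDoubling D M → IsLLC L M →
        ∀ (S : Set M) (x y : M) (r : ℝ), IsClosed S → 0 < r →
          x ∈ Sᶜ → y ∈ Sᶜ →
          connectedComponentIn Sᶜ x ≠ connectedComponentIn Sᶜ y →
          (∀ s ∈ S, r ≤ dist s x) → (∀ s ∈ S, r ≤ dist s y) →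
          ENNReal.ofReal (c * r ^ (n - 1)) ≤ μH[(n : ℝ) - 1] S := by
  obtain ⟨m, rfl⟩ : ∃ m, n = m + 1 := ⟨n - 1, by omega⟩
  have hR := SmallSimplices.one_le_rad hL (m + 2)
  have hR0 : 0 < SmallSimplices.rad L (m + 2) := by linarith
  set θ : ℝ := 1 / (160 * SmallSimplices.rad L (m + 2)) with hθ
  have hθ0 : 0 < θ := by positivity
  have hD' : (0 : ℝ) < ((D ^ 3) ^ m : ℕ) := by exact_mod_cast by positivity
  refine ⟨θ ^ m / (2 * ((D ^ 3) ^ m : ℕ)), by positivity, ?_⟩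
  intro M _ _ _ _ _ hM hDM hLLC S x y r hS hr hx hy hxy hxS hyS
  by_contra! h
  refine SmallSimplices.not_hasCover_of_separates hL hM hLLC hS hr hx hy hxy hxS hyS ?_
  have hθr : r / (32 * SmallSimplices.rad L (m + 2)) = 5 * (θ * r) := by
    rw [hθ]; field_simp; norm_num
  rw [hθr]
  refine SmallSimplices.hasCover_of_doubling hDM hS.isCompact (by positivity) ?_
  have he : ((m + 1 : ℕ) : ℝ) - 1 = (m : ℝ) := by push_cast; ring
  rw [he, Nat.add_sub_cancel] at h
  calc (((D ^ 3) ^ m : ℕ) : ENNReal) * μH[(m : ℝ)] S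
      ≤ ((D ^ 3) ^ m : ℕ) *
        ENNReal.ofReal (θ ^ m / (2 * ((D ^ 3) ^ m : ℕ)) * r ^ m) := by gcongr
    _ = ENNReal.ofReal ((θ * r) ^ m / 2) := by
      rw [← ENNReal.ofReal_natCast, ← ENNReal.ofReal_mul (by positivity)]
      congr 1
      rw [mul_pow]
      field_simp
    _ < ENNReal.ofReal ((θ * r) ^ m) := by
      have : 0 < (θ * r) ^ m := by positivity
      exact (ENNReal.ofReal_lt_ofReal_iff this).2 (by linarith)
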